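/- Let u be a viscosity solution of λ (det D²u)^p ≤ u_t ≤ Λ (det D²u)^p in Ω × [−T,0] with 0 ∈ Ω. Assume u(0,0) = 0, u(x,0) ≥ |x·e_n| for all x ∈ Ω, and 0 is an extremal point of the convex set D := {x ∈ Ω : u(x,0) = 0}. Then u(x,−T) ≥ |x·e_n| for all x ∈ Ω. -/

import Mathlib

open Set Metric MeasureTheory
open scoped RealInnerProductSpace

noncomputable section

abbrev E (n : ℕ) := EuclideanSpace ℝ (Fin n)

variable {n : ℕ}

/-- The time derivative `∂ₜφ(x,t)`. -/
noncomputable def timeDeriv (φ : E n → ℝ → ℝ) (x : E n) (t : ℝ) : ℝ :=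
  deriv (φ x) t

/-- The spatial Hessian matrix `D²φ(x,t)` (in the standard coordinates). -/
noncomputable def hessMatrix (φ : E n → ℝ → ℝ) (x : E n) (t : ℝ) :
    Matrix (Fin n) (Fin n) ℝ :=
  Matrix.of fun i j =>
    fderiv ℝ (fun y => fderiv ℝ (fun z => φ z t) y (EuclideanSpace.single j (1:ℝ))) x
      (EuclideanSpace.single i (1:ℝ))

/-- `φ` is an admissible test function near `(x₀,t₀)`: C² in `x` and C¹ in `t` nearby. -/
def IsTestAt (φ : E n → ℝ → ℝ) (x₀ : E n) (t₀ : ℝ) : Prop :=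
  ∃ ε > (0:ℝ),
    (∀ t ∈ ball t₀ ε, ContDiffOn ℝ 2 (fun x => φ x t) (ball x₀ ε)) ∧
    (∀ x ∈ ball x₀ ε, ContDiffOn ℝ 1 (fun t => φ x t) (ball t₀ ε))

/-- `u - φ` attains a local maximum at `(x₀,t₀)` among times `t ≤ t₀`,
relative to `closure Ω × [t₁,t₂]`. -/
def LocalMaxBelow (Ω : Set (E n)) (t₁ t₂ : ℝ) (u φ : E n → ℝ → ℝ)
    (x₀ : E n) (t₀ : ℝ) : Prop :=
  ∃ ε > (0:ℝ), ∀ x ∈ closure Ω, ∀ t ∈ Icc t₁ t₂, t ≤ t₀ →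
    dist x x₀ < ε → dist t t₀ < ε →
    u x t - φ x t ≤ u x₀ t₀ - φ x₀ t₀

/-- `u - φ` attains a local minimum at `(x₀,t₀)` among times `t ≤ t₀`. -/
def LocalMinBelow (Ω : Set (E n)) (t₁ t₂ : ℝ) (u φ : E n → ℝ → ℝ)
    (x₀ : E n) (t₀ : ℝ) : Prop :=
  ∃ ε > (0:ℝ), ∀ x ∈ closure Ω, ∀ t ∈ Icc t₁ t₂, t ≤ t₀ →
    dist x x₀ < ε → dist t t₀ < ε →
    u x₀ t₀ - φ x₀ t₀ ≤ u x t - φ x t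

/-- Viscosity subsolution of `u_t ≤ Λ (det D²u)^p` on `Ω × [t₁,t₂]`. -/
def ViscSubsolution (Lam p : ℝ) (Ω : Set (E n)) (t₁ t₂ : ℝ) (u : E n → ℝ → ℝ) : Prop :=
  ∀ x₀ ∈ Ω, ∀ t₀ ∈ Ioc t₁ t₂, ∀ φ : E n → ℝ → ℝ, IsTestAt φ x₀ t₀ →
    LocalMaxBelow Ω t₁ t₂ u φ x₀ t₀ →
    timeDeriv φ x₀ t₀ ≤ Lam * max (hessMatrix φ x₀ t₀).det 0 ^ p

/-- Viscosity supersolution of `u_t ≥ λ (det D²u)^p` on `Ω × [t₁,t₂]`. -/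
def ViscSupersolution (lam p : ℝ) (Ω : Set (E n)) (t₁ t₂ : ℝ) (u : E n → ℝ → ℝ) : Prop :=
  ∀ x₀ ∈ Ω, ∀ t₀ ∈ Ioc t₁ t₂, ∀ φ : E n → ℝ → ℝ, IsTestAt φ x₀ t₀ →
    LocalMinBelow Ω t₁ t₂ u φ x₀ t₀ →
    (hessMatrix φ x₀ t₀).PosSemidef →
    lam * (hessMatrix φ x₀ t₀).det ^ p ≤ timeDeriv φ x₀ t₀

/-- The regularity/structure assumptions: continuity on `closure Ω × [t₁,t₂]`,
convexity in `x`, monotonicity in `t`. -/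
structure ParabolicRegular (Ω : Set (E n)) (t₁ t₂ : ℝ) (u : E n → ℝ → ℝ) : Prop where
  cont : ContinuousOn (fun q : E n × ℝ => u q.1 q.2) (closure Ω ×ˢ Icc t₁ t₂)
  conv : ∀ t ∈ Icc t₁ t₂, ConvexOn ℝ (closure Ω) (fun x => u x t)
  mono : ∀ x ∈ closure Ω, ∀ s ∈ Icc t₁ t₂, ∀ t ∈ Icc t₁ t₂, s ≤ t → u x s ≤ u x t

/-- Viscosity solution of `λ (det D²u)^p ≤ u_t ≤ Λ (det D²u)^p` on `Ω × [t₁,t₂]`. -/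
def ViscositySolution (lam Lam p : ℝ) (Ω : Set (E n)) (t₁ t₂ : ℝ) (u : E n → ℝ → ℝ) : Prop :=
  ParabolicRegular Ω t₁ t₂ u ∧ ViscSubsolution Lam p Ω t₁ t₂ u ∧
    ViscSupersolution lam p Ω t₁ t₂ u

/-- `w` is `C^{1,α}` at `x₀` (relative to the set `D`) with some finite constant. -/
def C1AlphaAt (w : E n → ℝ) (D : Set (E n)) (α : ℝ) (x₀ : E n) : Prop :=
  ∃ C a : ℝ, ∃ q : E n, ∀ x ∈ D, |w x - (a + ⟪q, x - x₀⟫)| ≤ C * ‖x - x₀‖ ^ (1 + α)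

/-- `w` is `C^{1,α}` at `x₀` in the direction `e` (relative to the set `D`). -/
def C1AlphaDirAt (w : E n → ℝ) (D : Set (E n)) (α : ℝ) (x₀ e : E n) : Prop :=
  ∃ C a q : ℝ, ∀ s : ℝ, x₀ + s • e ∈ D →
    |w (x₀ + s • e) - (a + q * s)| ≤ C * |s| ^ (1 + α)

/-- A convex set `S` is `d`-balanced with respect to `x₀`. -/
def DBalanced (d : ℝ) (S : Set (E n)) (x₀ : E n) : Prop :=
  ∃ A : E n →ₗ[ℝ] E n, Function.Bijective A ∧
    ball (0 : E n) 1 ⊆ A '' ((fun y => y - x₀) '' S) ∧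
    A '' ((fun y => y - x₀) '' S) ⊆ ball (0 : E n) d

/-- `x₀` is an extremal point of the convex set `D`. -/
def ExtremalPoint (D : Set (E n)) (x₀ : E n) : Prop :=
  ¬ ∃ y ∈ closure D, ∃ z ∈ closure D, ∃ t : ℝ,
      0 < t ∧ t < 1 ∧ y ≠ z ∧ x₀ = t • y + (1 - t) • z

/-- The quadratic functions, with coefficients affine in time, used as test functions. -/
def quadTest (a₀ a₁ b₀ b₁ : ℝ) (v xc : E n) (A : E n →L[ℝ] E n) (x : E n) (t : ℝ) : ℝ :=
  a₀ + a₁ * t + ⟪v, x⟫ + (b₀ + b₁ * t) * ‖A (x - xc)‖ ^ 2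

lemma contDiff_quadTest_space (a₀ a₁ b₀ b₁ : ℝ) (v xc : E n) (A : E n →L[ℝ] E n) (t : ℝ) :
    ContDiff ℝ 2 fun x => quadTest a₀ a₁ b₀ b₁ v xc A x t := by
  unfold quadTest
  have h1 : ContDiff ℝ 2 fun x : E n => A (x - xc) :=
    A.contDiff.comp (contDiff_id.sub contDiff_const)
  have h2 : ContDiff ℝ 2 fun x : E n => ⟪v, x⟫ := contDiff_const.inner ℝ contDiff_id
  exact (contDiff_const.add h2).add (contDiff_const.mul (h1.norm_sq ℝ))

lemma isTestAt_quadTest (a₀ a₁ b₀ b₁ : ℝ) (v xc : E n) (A : E n →L[ℝ] E n) (x₀ : E n) (t₀ : ℝ) :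
    IsTestAt (quadTest a₀ a₁ b₀ b₁ v xc A) x₀ t₀ := by
  refine ⟨1, one_pos, fun t _ => (contDiff_quadTest_space ..).contDiffOn, fun x _ => ?_⟩
  unfold quadTest
  fun_prop

lemma timeDeriv_quadTest (a₀ a₁ b₀ b₁ : ℝ) (v xc : E n) (A : E n →L[ℝ] E n) (x : E n) (t : ℝ) :
    timeDeriv (quadTest a₀ a₁ b₀ b₁ v xc A) x t = a₁ + b₁ * ‖A (x - xc)‖ ^ 2 := by
  have h1 : HasDerivAt (fun t : ℝ => a₀ + a₁ * t + ⟪v, x⟫ + (b₀ + b₁ * t) * ‖A (x - xc)‖ ^ 2)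
      (a₁ * 1 + (b₁ * 1) * ‖A (x - xc)‖ ^ 2) t :=
    ((((hasDerivAt_id t).const_mul a₁).const_add a₀).add_const _).add
      ((((hasDerivAt_id t).const_mul b₁).const_add b₀).mul_const _)
  unfold timeDeriv quadTest
  rw [h1.deriv]; ring

lemma hasFDerivAt_quadTest (a₀ a₁ b₀ b₁ : ℝ) (v xc : E n) (A : E n →L[ℝ] E n) (x : E n) (t : ℝ) :
    HasFDerivAt (fun z => quadTest a₀ a₁ b₀ b₁ v xc A z t)
      (innerSL ℝ v + (b₀ + b₁ * t) • (2 • (innerSL ℝ (A (x - xc))).comp A)) x := by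
  unfold quadTest
  have h1 : HasFDerivAt (fun x : E n => A (x - xc)) A x :=
    A.hasFDerivAt.comp x ((hasFDerivAt_id x).sub_const xc)
  have h2 : HasFDerivAt (fun x : E n => ⟪v, x⟫) (innerSL ℝ v) x := (innerSL ℝ v).hasFDerivAt
  exact (h2.const_add _).add (h1.norm_sq.const_mul _)

lemma hessMatrix_quadTest (a₀ a₁ b₀ b₁ : ℝ) (v xc : E n) (A : E n →L[ℝ] E n) (x : E n) (t : ℝ) :
    hessMatrix (quadTest a₀ a₁ b₀ b₁ v xc A) x t =
      (2 * (b₀ + b₁ * t)) • (((LinearMap.toMatrix (EuclideanSpace.basisFun (Fin n) ℝ).toBasis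
        (EuclideanSpace.basisFun (Fin n) ℝ).toBasis A.toLinearMap).transpose) *
        (LinearMap.toMatrix (EuclideanSpace.basisFun (Fin n) ℝ).toBasis
        (EuclideanSpace.basisFun (Fin n) ℝ).toBasis A.toLinearMap)) := by
  ext i j
  set ei : E n := EuclideanSpace.single i (1 : ℝ)
  set ej : E n := EuclideanSpace.single j (1 : ℝ)
  have h1 : (fun y => fderiv ℝ (fun z => quadTest a₀ a₁ b₀ b₁ v xc A z t) y ej) =
      fun y => ⟪v, ej⟫ + (b₀ + b₁ * t) * (2 * ⟪A ej, A (y - xc)⟫) := by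
    ext y
    rw [(hasFDerivAt_quadTest a₀ a₁ b₀ b₁ v xc A y t).fderiv]
    simp only [add_apply, smul_apply,
      ContinuousLinearMap.comp_apply, innerSL_apply_apply, smul_eq_mul, nsmul_eq_mul,
      real_inner_comm (A ej)]
    norm_num
  have h2 : HasFDerivAt (fun y : E n => ⟪A ej, A (y - xc)⟫)
      ((innerSL ℝ (A ej)).comp A) x :=
    (innerSL ℝ (A ej)).hasFDerivAt.comp x
      (A.hasFDerivAt.comp x ((hasFDerivAt_id x).sub_const xc))
  have h3 := (((h2.const_mul 2).const_mul (b₀ + b₁ * t)).const_add ⟪v, ej⟫)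
  unfold hessMatrix
  simp only [Matrix.of_apply]
  rw [h1, h3.fderiv]
  have h4 : ⟪A ej, A ei⟫ = ∑ k, (A ei) k * (A ej) k := by
    simp [PiLp.inner_apply]
  simp [Matrix.mul_apply, LinearMap.toMatrix_apply, h4, ei, ej]
  ring

lemma det_hessMatrix_quadTest (a₀ a₁ b₀ b₁ : ℝ) (v xc : E n) (A : E n →L[ℝ] E n) (x : E n)
    (t : ℝ) :
    (hessMatrix (quadTest a₀ a₁ b₀ b₁ v xc A) x t).det =
      (2 * (b₀ + b₁ * t)) ^ n * LinearMap.det A.toLinearMap ^ 2 := by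
  rw [hessMatrix_quadTest, Matrix.det_smul, Matrix.det_mul, Matrix.det_transpose,
    LinearMap.det_toMatrix, Fintype.card_fin, sq]

lemma posSemidef_hessMatrix_quadTest (a₀ a₁ b₀ b₁ : ℝ) (v xc : E n) (A : E n →L[ℝ] E n) (x : E n)
    (t : ℝ) (h : 0 ≤ b₀ + b₁ * t) :
    (hessMatrix (quadTest a₀ a₁ b₀ b₁ v xc A) x t).PosSemidef := by
  rw [hessMatrix_quadTest]
  refine Matrix.PosSemidef.smul ?_ (by positivity)
  exact Matrix.posSemidef_conjTranspose_mul_self _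

lemma continuous_quadTest (a₀ a₁ b₀ b₁ : ℝ) (v xc : E n) (A : E n →L[ℝ] E n) :
    Continuous fun q : E n × ℝ => quadTest a₀ a₁ b₀ b₁ v xc A q.1 q.2 := by
  unfold quadTest
  fun_prop

/-- Comparison of a subsolution with a quadratic polynomial moving upwards in time. -/
lemma subsolution_le_quadratic {Lam p T : ℝ} {Ω : Set (E n)} {u : E n → ℝ → ℝ} (hLam : 0 ≤ Lam)
    (hreg : ParabolicRegular Ω (-T) 0 u) (hsub : ViscSubsolution Lam p Ω (-T) 0 u)
    {W O : Set (E n)} (hW : IsCompact W) (hWΩ : W ⊆ Ω) (hO : IsOpen O) (hOW : O ⊆ W)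
    {t₁ t₂ : ℝ} (ht₁ : -T ≤ t₁) (ht : t₁ < t₂) (ht₂ : t₂ ≤ 0) {a b : ℝ} (v xc : E n)
    (A : E n →L[ℝ] E n) (hb : 0 ≤ b)
    (h₁ : ∀ x ∈ W, u x t₁ ≤ a + ⟪v, x⟫ + b * ‖A (x - xc)‖ ^ 2)
    (h₂ : ∀ x ∈ W, x ∉ O → u x t₂ ≤ a + ⟪v, x⟫ + b * ‖A (x - xc)‖ ^ 2) :
    ∀ x ∈ W, u x t₂ ≤ a + ⟪v, x⟫ + b * ‖A (x - xc)‖ ^ 2 +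
      Lam * ((2 * b) ^ n * LinearMap.det A.toLinearMap ^ 2) ^ p * (t₂ - t₁) := by
  intro x₁ hx₁
  by_contra! hcon
  set rate := Lam * ((2 * b) ^ n * LinearMap.det A.toLinearMap ^ 2) ^ p with hrate
  have hrate0 : 0 ≤ rate := by positivity
  have htt : 0 < t₂ - t₁ := by linarith
  obtain ⟨m, hm1, hm2⟩ : ∃ m, rate < m ∧
      m < (u x₁ t₂ - (a + ⟪v, x₁⟫ + b * ‖A (x₁ - xc)‖ ^ 2)) / (t₂ - t₁) :=
    exists_between ((lt_div_iff₀ htt).2 (by linarith))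
  rw [lt_div_iff₀ htt] at hm2
  set φ := quadTest (a - m * t₁) m b 0 v xc A with hφ
  have hφe : ∀ x t, φ x t = a + ⟪v, x⟫ + b * ‖A (x - xc)‖ ^ 2 + m * (t - t₁) := by
    intro x t; simp only [hφ, quadTest]; ring
  have hcl : W ⊆ closure Ω := hWΩ.trans subset_closure
  have hcont : ContinuousOn (fun q : E n × ℝ => u q.1 q.2 - φ q.1 q.2) (W ×ˢ Icc t₁ t₂) := by
    refine (hreg.cont.mono (prod_mono hcl (Icc_subset_Icc ht₁ ht₂))).sub ?_
    exact (continuous_quadTest ..).continuousOn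
  obtain ⟨⟨x₀, t₀⟩, hq, hmax⟩ := (hW.prod isCompact_Icc).exists_isMaxOn
    ⟨(x₁, t₂), hx₁, right_mem_Icc.2 ht.le⟩ hcont
  have hx₀ : x₀ ∈ W := hq.1
  have ht₀ : t₀ ∈ Icc t₁ t₂ := hq.2
  have hpos : 0 < u x₀ t₀ - φ x₀ t₀ := by
    have h := hmax (show (x₁, t₂) ∈ W ×ˢ Icc t₁ t₂ from ⟨hx₁, right_mem_Icc.2 ht.le⟩)
    simp only [mem_ofPred_eq, hφe] at h
    rw [hφe]
    linarith
  have hmt : 0 ≤ m * (t₀ - t₁) := mul_nonneg (by linarith) (by linarith [ht₀.1])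
  have hne : t₁ < t₀ := by
    rcases eq_or_lt_of_le ht₀.1 with h | h
    · have := h₁ x₀ hx₀
      rw [hφe, ← h] at hpos
      linarith
    · exact h
  have hxO : x₀ ∈ O := by
    by_contra hx
    have h3 := h₂ x₀ hx₀ hx
    have h4 := hreg.mono x₀ (hcl hx₀) t₀ ⟨by linarith, by linarith [ht₀.2]⟩ t₂
      ⟨by linarith, ht₂⟩ ht₀.2
    rw [hφe] at hpos
    linarith
  obtain ⟨ε, hε, hball⟩ := Metric.isOpen_iff.1 hO x₀ hxO
  have hlm : LocalMaxBelow Ω (-T) 0 u φ x₀ t₀ := by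
    refine ⟨min ε (t₀ - t₁), lt_min hε (by linarith), fun x _ t _ htle hdx hdt => ?_⟩
    have hxW : x ∈ W := hOW (hball (hdx.trans_le (min_le_left _ _)))
    have hdt' := hdt.trans_le (min_le_right _ _)
    rw [Real.dist_eq, abs_lt] at hdt'
    exact hmax (show (x, t) ∈ W ×ˢ Icc t₁ t₂ from ⟨hxW, by linarith, by linarith [ht₀.2]⟩)
  have := hsub x₀ (hWΩ hx₀) t₀ ⟨by linarith, by linarith [ht₀.2]⟩ φ (isTestAt_quadTest ..) hlm
  rw [hφ, timeDeriv_quadTest, det_hessMatrix_quadTest, zero_mul, zero_mul, add_zero, add_zero,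
    max_eq_left (by positivity)] at this
  linarith

/-- A supersolution which at the initial time stays above an affine function on the outer half of
an ellipsoid cannot stay below it at the centre for a long time. -/
lemma supersolution_time_bound {lam p T : ℝ} {Ω : Set (E n)} {u : E n → ℝ → ℝ} (hlam : 0 ≤ lam)
    (hp : 0 < p)
    (hreg : ParabolicRegular Ω (-T) 0 u) (hsup : ViscSupersolution lam p Ω (-T) 0 u)
    (A : E n →L[ℝ] E n) {ρ : ℝ} (hρ : 0 < ρ) (hW : IsCompact {x | ‖A x‖ ≤ 2 * ρ})
    (hWΩ : {x | ‖A x‖ ≤ 2 * ρ} ⊆ Ω)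
    {t₁ t₂ : ℝ} (ht₁ : -T ≤ t₁) (ht : t₁ < t₂) (ht₂ : t₂ ≤ 0) {a d c : ℝ} (v : E n)
    (hc : 0 < c) (hcd : c ≤ 2 * d)
    (h₁ : ∀ x, ‖A x‖ ≤ 2 * ρ → ρ ≤ ‖A x‖ → a + ⟪v, x⟫ ≤ u x t₁)
    (h₂ : ∀ x, ‖A x‖ ≤ 2 * ρ → a + ⟪v, x⟫ - d ≤ u x t₁)
    (h₀ : u 0 t₂ < a - c) :
    (t₂ - t₁) * (lam * ((2 * (c / (4 * ρ ^ 2))) ^ n * LinearMap.det A.toLinearMap ^ 2) ^ p) ≤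
      2 * d - c := by
  set W := {x | ‖A x‖ ≤ 2 * ρ} with hWdef
  have htt : 0 < t₂ - t₁ := by linarith
  set κ := (2 * d - c) / (t₂ - t₁) with hκ
  have hκm : κ * (t₂ - t₁) = 2 * d - c := by rw [hκ]; field_simp
  have hκ0 : 0 ≤ κ := div_nonneg (by linarith) htt.le
  set φ := quadTest (a - (2 * d + κ * t₁)) κ ((2 * d + κ * t₁) / (4 * ρ ^ 2)) (-κ / (4 * ρ ^ 2))
    v 0 A with hφ
  have hφe : ∀ x t, φ x t = a + ⟪v, x⟫ -
      (2 * d - κ * (t - t₁)) * (1 - ‖A x‖ ^ 2 / (4 * ρ ^ 2)) := by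
    intro x t; simp only [hφ, quadTest, sub_zero]; ring
  have hcl : W ⊆ closure Ω := hWΩ.trans subset_closure
  have h0W : (0 : E n) ∈ W := by simp [hWdef, hρ.le]
  have hcont : ContinuousOn (fun q : E n × ℝ => u q.1 q.2 - φ q.1 q.2) (W ×ˢ Icc t₁ t₂) := by
    refine (hreg.cont.mono (prod_mono hcl (Icc_subset_Icc ht₁ ht₂))).sub ?_
    exact (continuous_quadTest ..).continuousOn
  obtain ⟨⟨x₀, t₀⟩, hq, hmin⟩ := (hW.prod isCompact_Icc).exists_isMinOn
    ⟨(0, t₂), h0W, right_mem_Icc.2 ht.le⟩ hcont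
  have hx₀ : x₀ ∈ W := hq.1
  have ht₀ : t₀ ∈ Icc t₁ t₂ := hq.2
  have hneg : u x₀ t₀ - φ x₀ t₀ < 0 := by
    have h := hmin (show ((0 : E n), t₂) ∈ W ×ˢ Icc t₁ t₂ from ⟨h0W, right_mem_Icc.2 ht.le⟩)
    simp only [mem_ofPred_eq] at h
    have h3 := hφe 0 t₂
    simp only [inner_zero_right, map_zero, norm_zero, hκm, ne_eq, OfNat.ofNat_ne_zero,
      not_false_eq_true, zero_pow, zero_div, sub_zero, mul_one] at h3
    linarith
  have hct : c ≤ 2 * d - κ * (t₀ - t₁) := by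
    have : κ * (t₀ - t₁) ≤ κ * (t₂ - t₁) := by gcongr; exact ht₀.2
    linarith
  have hquad : ∀ x ∈ W, 0 ≤ 1 - ‖A x‖ ^ 2 / (4 * ρ ^ 2) := by
    intro x hx
    rw [sub_nonneg, div_le_one (by positivity)]
    have : ‖A x‖ ≤ 2 * ρ := hx
    nlinarith [norm_nonneg (A x)]
  have hmo : u x₀ t₁ ≤ u x₀ t₀ := hreg.mono x₀ (hcl hx₀) t₁ ⟨ht₁, by linarith⟩ t₀
      ⟨by linarith [ht₀.1], by linarith [ht₀.2]⟩ ht₀.1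
  have hin : ‖A x₀‖ < ρ := by
    by_contra! hx
    have h3 := h₁ x₀ hx₀ hx
    have h5 := mul_nonneg (hc.le.trans hct) (hquad x₀ hx₀)
    rw [hφe] at hneg
    linarith
  have hne : t₁ < t₀ := by
    rcases eq_or_lt_of_le ht₀.1 with h | h
    · have h3 := h₂ x₀ hx₀
      have h4 : ‖A x₀‖ ^ 2 / (4 * ρ ^ 2) ≤ 1 / 4 := by
        rw [div_le_iff₀ (by positivity)]
        nlinarith [norm_nonneg (A x₀)]
      rw [hφe, ← h, sub_self, mul_zero, sub_zero] at hneg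
      nlinarith
    · exact h
  have hO : IsOpen {x | ‖A x‖ < 2 * ρ} := isOpen_lt (by fun_prop) continuous_const
  obtain ⟨ε, hε, hball⟩ := Metric.isOpen_iff.1 hO x₀ (by simp only [mem_ofPred_eq]; linarith)
  have hlm : LocalMinBelow Ω (-T) 0 u φ x₀ t₀ := by
    refine ⟨min ε (t₀ - t₁), lt_min hε (by linarith), fun x _ t _ htle hdx hdt => ?_⟩
    have hxW : x ∈ W := (show ‖A x‖ < 2 * ρ from hball (hdx.trans_le (min_le_left _ _))).le
    have hdt' := hdt.trans_le (min_le_right _ _)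
    rw [Real.dist_eq, abs_lt] at hdt'
    exact hmin (show (x, t) ∈ W ×ˢ Icc t₁ t₂ from ⟨hxW, by linarith, by linarith [ht₀.2]⟩)
  have hbt : (2 * d + κ * t₁) / (4 * ρ ^ 2) + -κ / (4 * ρ ^ 2) * t₀ =
      (2 * d - κ * (t₀ - t₁)) / (4 * ρ ^ 2) := by ring
  have key := hsup x₀ (hWΩ hx₀) t₀ ⟨by linarith, by linarith [ht₀.2]⟩ φ (isTestAt_quadTest ..) hlm
    (posSemidef_hessMatrix_quadTest _ _ _ _ _ _ _ _ _ (by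
      rw [hbt]; exact div_nonneg (hc.le.trans hct) (by positivity)))
  rw [hφ, timeDeriv_quadTest, det_hessMatrix_quadTest, hbt] at key
  have h6 : κ + -κ / (4 * ρ ^ 2) * ‖A (x₀ - 0)‖ ^ 2 ≤ κ := by
    have : 0 ≤ κ / (4 * ρ ^ 2) * ‖A (x₀ - 0)‖ ^ 2 := by positivity
    rw [neg_div]; linarith
  have h7 : lam * ((2 * (c / (4 * ρ ^ 2))) ^ n * LinearMap.det A.toLinearMap ^ 2) ^ p ≤
      lam * ((2 * ((2 * d - κ * (t₀ - t₁)) / (4 * ρ ^ 2))) ^ n *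
        LinearMap.det A.toLinearMap ^ 2) ^ p := by
    gcongr
  calc _ ≤ (t₂ - t₁) * κ := by gcongr; linarith
    _ = _ := by rw [mul_comm, hκm]

lemma Convex.smul_mem_of_neg_mem {F : Type*} [AddCommGroup F] [Module ℝ F] {Z : Set F}
    (hZ : Convex ℝ Z) {x : F} (hx : x ∈ Z) (hx' : -x ∈ Z) {a : ℝ} (ha : |a| ≤ 1) : a • x ∈ Z := by
  rw [abs_le] at ha
  have := hZ hx hx' (a := (1 + a) / 2) (b := (1 - a) / 2) (by linarith) (by linarith) (by ring)
  convert this using 1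
  module

/-- A symmetric convex body is comparable to an ellipsoid (via a maximal simplex). -/
lemma exists_ellipsoid_approx (hn : 1 ≤ n) {Z : Set (E n)} (hZ : Convex ℝ Z) (hc : IsCompact Z)
    (hsymm : ∀ x ∈ Z, -x ∈ Z) {δ : ℝ} (hδ : 0 < δ) (hball : closedBall (0 : E n) δ ⊆ Z) :
    ∃ A : E n ≃L[ℝ] E n, (∀ x, ‖A x‖ ≤ 1 → x ∈ Z) ∧ ∀ x ∈ Z, ‖A x‖ ≤ (n : ℝ) ^ 2 := by
  set e := (EuclideanSpace.basisFun (Fin n) ℝ).toBasis with he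
  have hcont : Continuous fun w : Fin n → E n => |e.det w| := by
    refine continuous_abs.comp ?_
    refine Continuous.congr (f := fun w : Fin n → E n => (e.toMatrix w).det) ?_
      fun w => (e.det_apply w).symm
    refine Continuous.matrix_det ?_
    refine continuous_matrix fun i j => ?_
    have : ∀ w : Fin n → E n, e.toMatrix w i j = w j i := fun w => by
      simp [Module.Basis.toMatrix_apply, he]
    refine Continuous.congr (f := fun w : Fin n → E n => w j i) ?_ fun w => (this w).symm
    fun_prop
  have hpi : IsCompact (Set.pi univ fun _ : Fin n => Z) := isCompact_univ_pi fun _ => hc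
  have hsm : (fun i => δ • e i) ∈ Set.pi univ fun _ : Fin n => Z := by
    intro i _
    refine hball ?_
    simp [he, norm_smul, abs_of_pos hδ]
  obtain ⟨w, hw, hmax⟩ := hpi.exists_isMaxOn ⟨_, hsm⟩ hcont.continuousOn
  have hpos : 0 < |e.det w| := by
    refine lt_of_lt_of_le ?_ (hmax hsm)
    change 0 < |e.det fun i => (fun _ => δ) i • e i|
    rw [AlternatingMap.map_smul_univ]
    simp [e.det_self, hδ.ne']
  have hne : e.det w ≠ 0 := abs_pos.1 hpos
  obtain ⟨hli, hsp⟩ := e.is_basis_iff_det.2 (isUnit_iff_ne_zero.2 hne)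
  set B := Module.Basis.mk hli hsp.ge with hB
  have hcoord : ∀ x ∈ Z, ∀ i, |B.repr x i| ≤ 1 := by
    intro x hx i
    have h1 := LinearMap.congr_fun (e.det_smul_mk_coord_eq_det_update hli hsp.ge i) x
    have h2 : |e.det (Function.update w i x)| ≤ |e.det w| := by
      refine hmax (show Function.update w i x ∈ _ from fun j _ => ?_)
      by_cases hj : j = i
      · subst hj; simpa using hx
      · simpa [hj] using hw j (mem_univ j)
    have h3 : e.det w * B.repr x i = e.det (Function.update w i x) := h1
    rw [← h3, abs_mul] at h2
    exact le_of_mul_le_mul_left (by simpa using h2) hpos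
  have hn0 : (0 : ℝ) < n := by exact_mod_cast hn
  set A₀ : E n ≃ₗ[ℝ] E n := (B.equivFun.trans (LinearEquiv.smulOfNeZero ℝ _ (n : ℝ) hn0.ne')).trans
    (WithLp.linearEquiv 2 ℝ (Fin n → ℝ)).symm with hA₀
  have hA : ∀ x i, (A₀ x) i = n * B.repr x i := by
    intro x i; simp [hA₀]
  refine ⟨A₀.toContinuousLinearEquiv, fun x hx => ?_, fun x hx => ?_⟩
  · have hx' : ‖A₀ x‖ ≤ 1 := hx
    have h1 : x = ∑ i, (1 / n : ℝ) • ((n * B.repr x i) • w i) := by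
      conv_lhs => rw [← B.sum_repr x]
      refine Finset.sum_congr rfl fun i _ => ?_
      rw [smul_smul, hB, Module.Basis.mk_apply]
      congr 1
      field_simp
    rw [h1]
    refine hZ.sum_mem (fun i _ => by positivity) (by simp [hn0.ne']) fun i _ => ?_
    refine Convex.smul_mem_of_neg_mem hZ (hw i (mem_univ i)) (hsymm _ (hw i (mem_univ i))) ?_
    rw [← hA, ← Real.norm_eq_abs]
    exact (PiLp.norm_apply_le _ i).trans hx'
  · change ‖A₀ x‖ ≤ _
    refine abs_le_of_sq_le_sq' ?_ (by positivity) |>.2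
    rw [EuclideanSpace.norm_sq_eq]
    have h1 : ∀ i, ‖(A₀ x) i‖ ^ 2 ≤ (n : ℝ) ^ 2 := by
      intro i
      rw [hA, Real.norm_eq_abs, sq_abs, mul_pow]
      have := hcoord x hx i
      have := (sq_le_one_iff_abs_le_one _).2 this
      nlinarith [sq_nonneg (n : ℝ)]
    calc _ ≤ ∑ i : Fin n, (n : ℝ) ^ 2 := Finset.sum_le_sum fun i _ => h1 i
      _ = n * (n : ℝ) ^ 2 := by simp
      _ ≤ _ := by
        have : (1 : ℝ) ≤ n := by exact_mod_cast hn
        have h4 : (0 : ℝ) ≤ n ^ 3 := by positivity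
        nlinarith

set_option maxHeartbeats 1000000 in
lemma three_le_of_mem_convexHull {ψ : E n → ℝ} {N ρ : ℝ} (hN : 0 ≤ N)
    (hρ : ρ = 2 * (n + 2) * (N + 1)) (hψ : ConvexOn ℝ (closedBall 0 ρ) ψ) (hψ0 : ψ 0 ≤ 0)
    (hlow : ∀ y, ‖y‖ ≤ ρ → -3 ≤ ψ y) (hup : ∀ y, ‖y‖ ≤ 1 → ψ y ≤ 9)
    (hsum : ∀ y, N < ‖y‖ → ‖y‖ ≤ ρ → 6 < ψ y + ψ (-y)) {r : ℝ}
    (hr : ((0 : E n), r) ∈ convexHull ℝ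
      ({z : E n × ℝ | ‖z.1‖ = ρ ∧ z.2 = ψ z.1} ∪ {z : E n × ℝ | ‖z.1‖ ≤ 1 ∧ 9 ≤ z.2})) :
    3 ≤ r := by
  classical
  have hn0 : (0 : ℝ) ≤ n := Nat.cast_nonneg n
  have hρ1 : 1 ≤ ρ := by rw [hρ]; nlinarith [mul_nonneg hn0 hN]
  obtain ⟨ι, _, z, w, hz, hai, hw, hw1, hwz⟩ := eq_pos_convex_span_of_mem_convexHull hr
  have hcard : (Fintype.card ι : ℝ) ≤ n + 2 := by
    have h1 := hai.card_le_finrank_succ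
    have h2 := Submodule.finrank_le (vectorSpan ℝ (Set.range z))
    simp only [Module.finrank_prod, finrank_euclideanSpace, Fintype.card_fin,
      Module.finrank_self] at h2
    have : Fintype.card ι ≤ n + 2 := by omega
    exact_mod_cast this
  have hz' : ∀ i, (‖(z i).1‖ = ρ ∧ (z i).2 = ψ (z i).1) ∨ (‖(z i).1‖ ≤ 1 ∧ 9 ≤ (z i).2) :=
    fun i => hz ⟨i, rfl⟩
  have hf : ∀ i, ‖(z i).1‖ ≤ ρ := fun i => by rcases hz' i with h | h <;> linarith [h.1]
  have hg : ∀ i, ψ (z i).1 ≤ (z i).2 := fun i => by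
    rcases hz' i with h | h
    · exact h.2.ge
    · exact (hup _ h.1).trans h.2
  have hg3 : ∀ i, -3 ≤ (z i).2 := fun i => (hlow _ (hf i)).trans (hg i)
  have hs1 : ∑ i, w i • (z i).1 = 0 := by
    have := congrArg Prod.fst hwz
    simpa [Prod.fst_sum] using this
  have hs2 : ∑ i, w i * (z i).2 = r := by
    have := congrArg Prod.snd hwz
    simpa [Prod.snd_sum] using this
  by_cases hG : 1 / 2 ≤ ∑ i with 9 ≤ (z i).2, w i
  · have h1 : ∑ i, w i * (-3 + 12 * if 9 ≤ (z i).2 then 1 else 0) ≤ r := by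
      rw [← hs2]
      refine Finset.sum_le_sum fun i _ => mul_le_mul_of_nonneg_left ?_ (hw i).le
      split_ifs with h
      · linarith
      · linarith [hg3 i]
    have h2 : ∑ i, w i * (-3 + 12 * if 9 ≤ (z i).2 then (1 : ℝ) else 0) =
        -3 * ∑ i, w i + 12 * ∑ i with 9 ≤ (z i).2, w i := by
      rw [Finset.sum_filter, Finset.mul_sum, Finset.mul_sum, ← Finset.sum_add_distrib]
      refine Finset.sum_congr rfl fun i _ => ?_
      split_ifs <;> ring
    rw [h2, hw1] at h1
    linarith
  push Not at hG
  obtain ⟨i₁, hi₁, hwi₁⟩ : ∃ i, ¬ 9 ≤ (z i).2 ∧ 1 / (2 * (n + 2)) ≤ w i := by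
    by_contra! hcon
    have h1 := Finset.sum_filter_add_sum_filter_not Finset.univ (fun i => 9 ≤ (z i).2) w
    have h2 : ∑ i with ¬ 9 ≤ (z i).2, w i ≤ ∑ i with ¬ 9 ≤ (z i).2, (1 / (2 * (n + 2)) : ℝ) :=
      Finset.sum_le_sum fun i hi => (hcon i (by simpa using hi)).le
    have h3 : ∑ i with ¬ 9 ≤ (z i).2, (1 / (2 * (n + 2)) : ℝ) ≤ ∑ i : ι, (1 / (2 * (n + 2)) : ℝ) :=
      Finset.sum_le_sum_of_subset_of_nonneg (Finset.filter_subset _ _) fun i _ _ => by positivity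
    have h4 : ∑ i : ι, (1 / (2 * (n + 2)) : ℝ) ≤ 1 / 2 := by
      rw [Finset.sum_const, Finset.card_univ, nsmul_eq_mul, mul_one_div, div_le_iff₀ (by positivity)]
      linarith
    rw [hw1] at h1
    linarith
  have hfi₁ : ‖(z i₁).1‖ = ρ := by
    rcases hz' i₁ with h | h
    · exact h.1
    · exact absurd h.2 hi₁
  set c := w i₁ with hc
  set y := (z i₁).1 with hy
  have e1 := Finset.add_sum_erase Finset.univ w (Finset.mem_univ i₁)
  have e2 := Finset.add_sum_erase Finset.univ (fun i => w i • (z i).1) (Finset.mem_univ i₁)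
  have e3 := Finset.add_sum_erase Finset.univ (fun i => w i * (z i).2) (Finset.mem_univ i₁)
  simp only [hw1, hs1, hs2] at e1 e2 e3
  have hc0 : 0 < c := hw i₁
  have hc2 : c ≤ 1 / 2 := by
    have h1 : c • y = -∑ i ∈ Finset.univ.erase i₁, w i • (z i).1 := by
      rw [eq_neg_iff_add_eq_zero]; exact e2
    have h2 : ‖c • y‖ ≤ ∑ i ∈ Finset.univ.erase i₁, w i * ρ := by
      rw [h1, norm_neg]
      refine norm_sum_le_of_le _ fun i _ => ?_
      rw [norm_smul, Real.norm_of_nonneg (hw i).le]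
      exact mul_le_mul_of_nonneg_left (hf i) (hw i).le
    rw [← Finset.sum_mul, norm_smul, hfi₁, Real.norm_of_nonneg hc0.le] at h2
    have := le_of_mul_le_mul_right h2 (by linarith)
    linarith
  have h1c : 0 < 1 - c := by linarith
  set θ := c / (1 - c) with hθ
  have hθ0 : 0 < θ := by positivity
  have hθ1 : θ ≤ 1 := by rw [hθ, div_le_one h1c]; linarith
  have hθc : θ * (1 - c) = c := by rw [hθ]; field_simp
  have hcρ : N < c * ρ := by
    have : 1 / (2 * (n + 2)) * ρ = N + 1 := by rw [hρ]; field_simp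
    have h3 : 1 / (2 * (n + 2)) * ρ ≤ c * ρ := by gcongr
    linarith
  have hnorm : ‖θ • y‖ = θ * ρ := by rw [norm_smul, hfi₁, Real.norm_of_nonneg hθ0.le]
  have hθρ : N < θ * ρ := by
    have : c ≤ θ := by rw [hθ, le_div_iff₀ h1c]; nlinarith
    nlinarith
  have hkey := hsum (θ • y) (by rw [hnorm]; exact hθρ) (by rw [hnorm]; nlinarith)
  have hneg : -(θ • y) = ∑ i ∈ Finset.univ.erase i₁, (w i / (1 - c)) • (z i).1 := by
    have h1 : ∑ i ∈ Finset.univ.erase i₁, w i • (z i).1 = -(c • y) := by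
      rw [eq_neg_iff_add_eq_zero, add_comm]; exact e2
    have h2 : ∑ i ∈ Finset.univ.erase i₁, (w i / (1 - c)) • (z i).1 =
        (1 - c)⁻¹ • ∑ i ∈ Finset.univ.erase i₁, w i • (z i).1 := by
      rw [Finset.smul_sum]
      refine Finset.sum_congr rfl fun i _ => ?_
      rw [smul_smul, div_eq_inv_mul]
    rw [h2, h1, smul_neg, smul_smul, hθ, div_eq_inv_mul]
  have hjen : ψ (-(θ • y)) ≤ ∑ i ∈ Finset.univ.erase i₁, (w i / (1 - c)) * (z i).2 := by
    rw [hneg]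
    refine (hψ.map_sum_le (fun i _ => div_nonneg (hw i).le h1c.le) ?_ fun i _ => ?_).trans
      (Finset.sum_le_sum fun i _ => ?_)
    · rw [← Finset.sum_div, div_eq_one_iff_eq h1c.ne']
      linarith
    · simpa using hf i
    · exact mul_le_mul_of_nonneg_left (hg i) (div_nonneg (hw i).le h1c.le)
  have hjen' : (1 - c) * ψ (-(θ • y)) ≤ ∑ i ∈ Finset.univ.erase i₁, w i * (z i).2 := by
    have h2 : ∑ i ∈ Finset.univ.erase i₁, w i * (z i).2 =
        (1 - c) * ∑ i ∈ Finset.univ.erase i₁, (w i / (1 - c)) * (z i).2 := by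
      rw [Finset.mul_sum]
      refine Finset.sum_congr rfl fun i _ => ?_
      field_simp
    rw [h2]
    gcongr
  have hcon : ψ (θ • y) ≤ θ * ψ y := by
    have h1 := hψ.2 (x := y) (y := 0) (by simpa using hfi₁.le) (by simp; linarith) hθ0.le
      (sub_nonneg.2 hθ1) (by ring)
    simp only [smul_zero, add_zero, smul_eq_mul] at h1
    nlinarith
  have h5 : c * ψ y ≤ c * (z i₁).2 := mul_le_mul_of_nonneg_left (hg i₁) hc0.le
  have h6 : (1 - c) * ψ (θ • y) ≤ c * ψ y := by
    calc _ ≤ (1 - c) * (θ * ψ y) := by gcongr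
      _ = θ * (1 - c) * ψ y := by ring
      _ = _ := by rw [hθc]
  nlinarith

/-- A convex function with controlled symmetrization lies, on a large sphere, above an affine
function with value `2` at the centre. -/
lemma exists_affine_le_on_sphere {ψ : E n → ℝ} {N ρ : ℝ} (hN : 0 ≤ N)
    (hρ : ρ = 2 * (n + 2) * (N + 1)) (hψ : ConvexOn ℝ (closedBall 0 ρ) ψ) (hψ0 : ψ 0 ≤ 0)
    (hlow : ∀ y, ‖y‖ ≤ ρ → -3 ≤ ψ y) (hup : ∀ y, ‖y‖ ≤ 1 → ψ y ≤ 9)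
    (hsum : ∀ y, N < ‖y‖ → ‖y‖ ≤ ρ → 6 < ψ y + ψ (-y)) :
    ∃ q : E n, ‖q‖ ≤ 7 ∧ ∀ y, ‖y‖ = ρ → 2 + ⟪q, y⟫ ≤ ψ y := by
  set X := convexHull ℝ
    ({z : E n × ℝ | ‖z.1‖ = ρ ∧ z.2 = ψ z.1} ∪ {z : E n × ℝ | ‖z.1‖ ≤ 1 ∧ 9 ≤ z.2}) with hX
  have hXb : ∀ b : E n, ∀ r : ℝ, ‖b‖ ≤ 1 → 9 ≤ r → (b, r) ∈ X := fun b r hb hr =>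
    subset_convexHull ℝ _ (Or.inr ⟨hb, hr⟩)
  have hXs : ∀ y : E n, ‖y‖ = ρ → (y, ψ y) ∈ X := fun y hy =>
    subset_convexHull ℝ _ (Or.inl ⟨hy, rfl⟩)
  have hnot : ((0 : E n), (2 : ℝ)) ∉ interior X := fun h => by
    have := three_le_of_mem_convexHull hN hρ hψ hψ0 hlow hup hsum (interior_subset h)
    linarith
  have hint : (interior X).Nonempty := by
    refine ⟨((0 : E n), (10 : ℝ)), mem_interior_iff_mem_nhds.2 ?_⟩
    refine Filter.mem_of_superset (prod_mem_nhds (closedBall_mem_nhds (0 : E n) one_pos)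
      (Ici_mem_nhds (show (9 : ℝ) < 10 by norm_num))) ?_
    rintro ⟨b, r⟩ ⟨hb, hr⟩
    exact hXb b r (by simpa using hb) hr
  obtain ⟨f, hf0, hf⟩ := geometric_hahn_banach_of_nonempty_interior_point
    (convex_convexHull ℝ _) hnot hint
  set β := f ((0 : E n), (1 : ℝ)) with hβ
  set g : StrongDual ℝ (E n) := f.comp (ContinuousLinearMap.inl ℝ (E n) ℝ) with hg
  have hfe : ∀ (y : E n) (r : ℝ), f (y, r) = g y + r * β := by
    intro y r
    have : ((y, r) : E n × ℝ) = (y, 0) + r • ((0 : E n), (1 : ℝ)) := by simp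
    rw [this, map_add, map_smul]
    simp [hg, hβ]
  have hball : ∀ b : E n, ‖b‖ ≤ 1 → ∀ r : ℝ, 9 ≤ r → g b + r * β ≤ 2 * β := by
    intro b hb r hr
    have := hf _ (hXb b r hb hr)
    rw [hfe, hfe] at this
    simpa using this
  have hβ0 : β ≤ 0 := by
    have := hball 0 (by simp) 9 le_rfl
    simp only [map_zero] at this
    linarith
  have hβneg : β < 0 := by
    rcases hβ0.lt_or_eq with h | h
    · exact h
    exfalso
    apply hf0
    have hgz : ∀ y, g y ≤ 0 := by
      intro y
      by_cases hy : y = 0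
      · simp [hy]
      have h1 := hball (‖y‖⁻¹ • y) (by simp [norm_smul, norm_ne_zero_iff.2 hy]) 9 le_rfl
      rw [h, map_smul, smul_eq_mul] at h1
      have : 0 < ‖y‖⁻¹ := inv_pos.2 (norm_pos_iff.2 hy)
      nlinarith
    ext y
    · have h1 := hgz y
      have h2 := hgz (-y)
      rw [map_neg] at h2
      have : g y = 0 := by linarith
      simpa [hg] using this
    · simpa [hβ] using h
  set q := (InnerProductSpace.toDual ℝ (E n)).symm ((-β)⁻¹ • g) with hq
  have hqe : ∀ y, ⟪q, y⟫ = (-β)⁻¹ * g y := fun y => by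
    rw [hq, InnerProductSpace.toDual_symm_apply]; rfl
  have hnb : 0 < (-β)⁻¹ := inv_pos.2 (by linarith)
  have hnbe : (-β)⁻¹ * β = -1 := by
    rw [inv_neg, neg_mul, inv_mul_cancel₀ hβneg.ne]
  refine ⟨q, ?_, fun y hy => ?_⟩
  · by_cases hq0 : q = 0
    · simp [hq0]
    have h1 := hball (‖q‖⁻¹ • q) (by simp [norm_smul, norm_ne_zero_iff.2 hq0]) 9 le_rfl
    have h2 := hqe (‖q‖⁻¹ • q)
    rw [inner_smul_right, real_inner_self_eq_norm_sq] at h2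
    have h3 : ‖q‖⁻¹ * ‖q‖ ^ 2 = ‖q‖ := by field_simp
    rw [h3] at h2
    nlinarith
  · have h1 := hf _ (hXs y hy)
    rw [hfe, hfe, map_zero] at h1
    rw [hqe]
    have h2 := mul_le_mul_of_nonneg_left h1 hnb.le
    have h3 : (-β)⁻¹ * (g y + ψ y * β) = (-β)⁻¹ * g y + ψ y * ((-β)⁻¹ * β) := by ring
    have h4 : (-β)⁻¹ * (0 + 2 * β) = 2 * ((-β)⁻¹ * β) := by ring
    rw [h3, h4, hnbe] at h2
    linarith

lemma ConvexOn.exists_inner_le {φ : E n → ℝ} {r : ℝ} (hr : 0 ≤ r)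
    (hφ : ConvexOn ℝ (closedBall 0 r) φ) (hc : ContinuousOn φ (closedBall 0 r)) {η : ℝ}
    (hη : 0 < η) : ∃ v : E n, ∀ x, ‖x‖ ≤ r → φ 0 - η + ⟪v, x⟫ ≤ φ x := by
  obtain ⟨l, c, hl, hl0⟩ := hφ.exists_affine_le_of_lt (𝕜 := ℝ) (x := 0) (a := φ 0 - η) (by simpa using hr)
    (by linarith) isClosed_closedBall hc.lowerSemicontinuousOn
  refine ⟨(InnerProductSpace.toDual ℝ (E n)).symm l, fun x hx => ?_⟩
  rw [InnerProductSpace.toDual_symm_apply]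
  have h1 := hl ⟨x, by simpa using hx⟩
  simp only [map_zero, zero_add] at hl0
  have h2 : l x + c ≤ φ x := h1
  linarith

/-- Near time `0`, the symmetrized sections at `0` are small, because `0` is an extremal point of
the zero set. -/
lemma exists_symm_section_subset {T : ℝ} {Ω : Set (E n)} {u : E n → ℝ → ℝ} (hT : 0 < T)
    (hreg : ParabolicRegular Ω (-T) 0 u) (hpos : ∀ x ∈ Ω, 0 ≤ u x 0)
    (hext : ExtremalPoint {x ∈ Ω | u x 0 = 0} 0) {r : ℝ} (hr : closedBall (0 : E n) r ⊆ Ω)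
    {ε : ℝ} (hε : 0 < ε) :
    ∃ h₀ > 0, ∃ τ₀ > 0, τ₀ ≤ T ∧ ∀ τ ∈ Icc (-τ₀) 0, ∀ x : E n, ‖x‖ ≤ r →
      u x τ + u (-x) τ ≤ 6 * h₀ → ‖x‖ < ε := by
  set S := closedBall (0 : E n) r ∩ {x | ε ≤ ‖x‖} with hS
  have hSc : IsCompact S := (isCompact_closedBall _ _).inter_right
    (isClosed_le continuous_const continuous_norm)
  have hcl : closedBall (0 : E n) r ⊆ closure Ω := hr.trans subset_closure
  have hcont : ContinuousOn (fun q : E n × ℝ => u q.1 q.2 + u (-q.1) q.2) (S ×ˢ Icc (-T) 0) := by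
    refine ContinuousOn.add ?_ ?_
    · exact hreg.cont.mono (prod_mono (inter_subset_left.trans hcl) le_rfl)
    · refine hreg.cont.comp (f := fun q : E n × ℝ => (-q.1, q.2)) (by fun_prop) ?_
      rintro ⟨x, t⟩ ⟨hx, ht⟩
      exact ⟨hcl (by simpa using hx.1), ht⟩
  have h0T : (0 : ℝ) ∈ Icc (-T) 0 := ⟨by linarith, le_rfl⟩
  obtain ⟨m, hm, hmS⟩ : ∃ m > 0, ∀ x ∈ S, m ≤ u x 0 + u (-x) 0 := by
    rcases S.eq_empty_or_nonempty with h | h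
    · exact ⟨1, one_pos, by simp [h]⟩
    have hc0 : ContinuousOn (fun x => u x 0 + u (-x) 0) S :=
      hcont.comp (f := fun x : E n => (x, (0 : ℝ))) (by fun_prop) fun x hx => ⟨hx, h0T⟩
    obtain ⟨x, hx, hmin⟩ := hSc.exists_isMinOn h hc0
    refine ⟨u x 0 + u (-x) 0, ?_, fun y hy => hmin hy⟩
    have hxΩ : x ∈ Ω := hr hx.1
    have hxΩ' : -x ∈ Ω := hr (by simpa using hx.1)
    have h1 := hpos x hxΩ
    have h2 := hpos (-x) hxΩ'
    by_contra hle
    have hx0 : x ≠ 0 := by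
      rintro rfl
      have : ε ≤ ‖(0 : E n)‖ := hx.2
      simp at this
      linarith
    refine hext ⟨x, subset_closure ⟨hxΩ, by linarith⟩, -x, subset_closure ⟨hxΩ', by linarith⟩,
      1 / 2, by norm_num, by norm_num, ?_, by module⟩
    intro h3
    have h4 : (2 : ℝ) • x = 0 := by
      rw [two_smul]
      exact eq_neg_iff_add_eq_zero.1 h3
    exact hx0 ((smul_eq_zero.1 h4).resolve_left two_ne_zero)
  have huc := (hSc.prod isCompact_Icc).uniformContinuousOn_of_continuous hcont
  obtain ⟨δ, hδ, hδ'⟩ := Metric.uniformContinuousOn_iff.1 huc (m / 2) (by positivity)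
  refine ⟨m / 12, by positivity, min T (δ / 2), lt_min hT (by positivity), min_le_left _ _,
    fun τ hτ x hx hux => ?_⟩
  by_contra! hεx
  have hxS : x ∈ S := ⟨by simpa using hx, hεx⟩
  have hτT : τ ∈ Icc (-T) 0 := ⟨by linarith [hτ.1, min_le_left T (δ / 2)], hτ.2⟩
  have h1 := hδ' (x, τ) ⟨hxS, hτT⟩ (x, 0) ⟨hxS, h0T⟩ (by
    rw [Prod.dist_eq, dist_self, Real.dist_eq, sub_zero, abs_of_nonpos hτ.2]
    have := min_le_right T (δ / 2)
    exact max_lt hδ (by linarith [hτ.1]))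
  rw [Real.dist_eq, abs_lt] at h1
  have h2 := hmS x hxS
  simp only at h1
  linarith [h1.1]

/-- An ellipsoid comparable to a symmetrized section of height `h` at `0`, together with an
approximate subgradient `v` and an affine function which lies below `φ` away from the ellipsoid. -/
lemma exists_section_normalization (hn : 1 ≤ n) {φ : E n → ℝ} {r h ε ρ : ℝ} (hr : 0 < r)
    (hh : 0 < h) (hφ : ConvexOn ℝ (closedBall 0 r) φ) (hc : ContinuousOn φ (closedBall 0 r))
    (hφ0 : φ 0 ≤ 0) (hφ0' : -(2 * h) ≤ φ 0)
    (hsec : ∀ x, ‖x‖ ≤ r → φ x + φ (-x) ≤ 6 * h → ‖x‖ < ε)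
    (hρ : ρ = 2 * (n + 2) * ((n : ℝ) ^ 2 + 1)) (hε : 2 * ρ * ε ≤ r) :
    ∃ (A : E n ≃L[ℝ] E n) (v v' : E n),
      (∀ x, ‖A x‖ ≤ 1 → ‖x‖ ≤ r ∧ ‖x‖ < ε ∧ φ x + φ (-x) ≤ 6 * h) ∧
      (∀ x, ‖A x‖ ≤ 1 → φ x ≤ ⟪v, x⟫ + 9 * h) ∧
      (∀ x, ‖A x‖ ≤ 2 * ρ → ‖x‖ ≤ r) ∧
      (∀ x, ‖A x‖ ≤ 2 * ρ → ρ ≤ ‖A x‖ → 2 * h + ⟪v', x⟫ ≤ φ x) ∧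
      (∀ x, ‖A x‖ ≤ 2 * ρ → 2 * h + ⟪v', x⟫ - (5 + 14 * ρ) * h ≤ φ x) := by
  have hρ0 : 0 < ρ := by rw [hρ]; positivity
  have hneg : ∀ x : E n, x ∈ closedBall 0 r → -x ∈ closedBall 0 r := fun x hx => by simpa using hx
  set B := closedBall (0 : E n) r with hB
  have h0B : (0 : E n) ∈ B := by simp [hB, hr.le]
  have hcs : ContinuousOn (fun x => φ x + φ (-x)) B :=
    hc.add (hc.comp continuous_neg.continuousOn hneg)
  have hφn : ConvexOn ℝ B (fun x => φ (-x)) := by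
    refine ⟨hφ.1, fun x hx y hy a b ha hb hab => ?_⟩
    have := hφ.2 (hneg x hx) (hneg y hy) ha hb hab
    rwa [smul_neg, smul_neg, ← neg_add] at this
  have hZconv : Convex ℝ {x ∈ B | φ x + φ (-x) ≤ 6 * h} := (hφ.add hφn).convex_le _
  have hZc : IsCompact {x ∈ B | φ x + φ (-x) ≤ 6 * h} := by
    have := hcs.preimage_isClosed_of_isClosed isClosed_closedBall (isClosed_Iic (a := 6 * h))
    exact (isCompact_closedBall (0 : E n) r).of_isClosed_subset this fun x hx => hx.1
  obtain ⟨δ, hδ, hδB⟩ : ∃ δ > 0, closedBall (0 : E n) δ ⊆ {x ∈ B | φ x + φ (-x) ≤ 6 * h} := by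
    have h1 : ∀ᶠ x in nhds (0 : E n), x ∈ B := closedBall_mem_nhds _ hr
    have h2 : ContinuousAt (fun x => φ x + φ (-x)) 0 := hcs.continuousAt h1
    have h3 : ∀ᶠ x in nhds (0 : E n), φ x + φ (-x) < 6 * h :=
      h2.eventually_lt continuousAt_const (by simp; linarith)
    obtain ⟨δ, hδ, hδ'⟩ := Metric.nhds_basis_closedBall.eventually_iff.1 (h1.and h3)
    exact ⟨δ, hδ, fun x hx => ⟨(hδ' hx).1, (hδ' hx).2.le⟩⟩
  obtain ⟨A, hA1, hA2⟩ := exists_ellipsoid_approx hn hZconv hZc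
    (fun x hx => ⟨hneg x hx.1, by rw [neg_neg, add_comm]; exact hx.2⟩) hδ hδB
  have hZr : ∀ x, ‖A x‖ ≤ 1 → ‖x‖ ≤ r ∧ ‖x‖ < ε ∧ φ x + φ (-x) ≤ 6 * h := fun x hx => by
    have h1 := hA1 x hx
    have h2 : ‖x‖ ≤ r := by simpa [hB] using h1.1
    exact ⟨h2, hsec x h2 h1.2, h1.2⟩
  obtain ⟨v, hv⟩ := hφ.exists_inner_le hr.le hc hh
  have hv' : ∀ x : E n, ‖x‖ ≤ r → -(3 * h) + ⟪v, x⟫ ≤ φ x := fun x hx => by linarith [hv x hx]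
  have hbig : ∀ x, ‖A x‖ ≤ 2 * ρ → ‖x‖ ≤ r := fun x hx => by
    have h1 : ‖A ((2 * ρ)⁻¹ • x)‖ ≤ 1 := by
      rw [map_smul, norm_smul, norm_inv, Real.norm_of_nonneg (by positivity)]
      rw [inv_mul_le_iff₀ (by positivity)]
      linarith
    have h2 := (hZr _ h1).2.1
    rw [norm_smul, norm_inv, Real.norm_of_nonneg (by positivity),
      inv_mul_lt_iff₀ (by positivity)] at h2
    linarith
  have hsymm : ∀ y : E n, ‖y‖ ≤ ρ → A.symm y ∈ B := fun y hy => by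
    have := hbig (A.symm y) (by simpa using by linarith)
    simpa [hB] using this
  have hup : ∀ x, ‖A x‖ ≤ 1 → φ x ≤ ⟪v, x⟫ + 9 * h := fun x hx => by
    obtain ⟨h1, -, h2⟩ := hZr x hx
    have h3 := hv' (-x) (by simpa using h1)
    rw [inner_neg_right] at h3
    linarith
  have hρ1 : 1 ≤ ρ := by
    rw [hρ]
    have : (0 : ℝ) ≤ n := by positivity
    nlinarith [sq_nonneg (n : ℝ), mul_nonneg this (sq_nonneg (n : ℝ))]
  obtain ⟨q, hq7, hq⟩ := exists_affine_le_on_sphere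
    (ψ := fun y => h⁻¹ * (φ (A.symm y) - ⟪v, A.symm y⟫)) (N := (n : ℝ) ^ 2) (by positivity) hρ
    (by
      refine ⟨convex_closedBall _ _, fun x hx y hy a b ha hb hab => ?_⟩
      have h1 := hφ.2 (hsymm x (by simpa using hx)) (hsymm y (by simpa using hy)) ha hb hab
      simp only [map_add, map_smul, inner_add_right, inner_smul_right, smul_eq_mul] at h1 ⊢
      have h2 := mul_le_mul_of_nonneg_left h1 (inv_nonneg.2 hh.le)
      linarith)
    (by
      simp only [map_zero, inner_zero_right, sub_zero]
      exact mul_nonpos_of_nonneg_of_nonpos (by positivity) hφ0)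
    (fun y hy => by
      have h1 := hv' _ (by simpa [hB] using hsymm y hy)
      rw [le_inv_mul_iff₀ hh]
      linarith)
    (fun y hy => by
      have h1 := hup (A.symm y) (by simpa using hy)
      rw [inv_mul_le_iff₀ hh]
      linarith)
    (fun y hNy hy => by
      have h1 : ¬ (φ (A.symm y) + φ (-A.symm y) ≤ 6 * h) := fun hle => by
        have := hA2 (A.symm y) ⟨hsymm y hy, hle⟩
        rw [A.apply_symm_apply] at this
        linarith
      simp only [map_neg, inner_neg_right]
      rw [← mul_add, lt_inv_mul_iff₀ hh]
      push Not at h1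
      linarith)
  have hin : ∀ x, ⟪v + h • (ContinuousLinearMap.adjoint (A : E n →L[ℝ] E n)) q, x⟫
      = ⟪v, x⟫ + h * ⟪q, A x⟫ := fun x => by
    rw [inner_add_left, real_inner_smul_left, ContinuousLinearMap.adjoint_inner_left]
    rfl
  refine ⟨A, v, v + h • (ContinuousLinearMap.adjoint (A : E n →L[ℝ] E n)) q, hZr, hup, hbig,
    fun x hx hx' => ?_, fun x hx => ?_⟩
  · rw [hin]
    have hpos : 0 < ‖A x‖ := by linarith
    set θ := ρ / ‖A x‖ with hθ
    have hθ0 : 0 < θ := by positivity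
    have hθ1 : θ ≤ 1 := (div_le_one hpos).2 hx'
    have hs : ‖θ • A x‖ = ρ := by
      rw [norm_smul, Real.norm_of_nonneg hθ0.le, hθ]
      field_simp
    have h1 := hq _ hs
    simp only [map_smul, A.symm_apply_apply, inner_smul_right] at h1
    rw [le_inv_mul_iff₀ hh] at h1
    have h2 := hφ.2 (show x ∈ B by simpa [hB] using hbig x hx) h0B hθ0.le (sub_nonneg.2 hθ1)
      (by ring)
    rw [smul_zero, add_zero, smul_eq_mul, smul_eq_mul] at h2
    have h3 : (1 - θ) * φ 0 ≤ 0 := mul_nonpos_of_nonneg_of_nonpos (by linarith) hφ0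
    have h4 : θ * (2 * h + (⟪v, x⟫ + h * ⟪q, A x⟫)) ≤ θ * φ x := by nlinarith
    exact le_of_mul_le_mul_left h4 hθ0
  · rw [hin]
    have h1 := hv' x (hbig x hx)
    have h2 : ⟪q, A x⟫ ≤ 14 * ρ := (real_inner_le_norm _ _).trans <| by
      nlinarith [norm_nonneg q, norm_nonneg (A x)]
    nlinarith

/-- Replacing `A` by a map which stretches the direction `e` differently but agrees with `A` on a
complement of `e`. -/
lemma exists_stretch (A : E n ≃L[ℝ] E n) {e : E n} (he : e ≠ 0) {s : ℝ} (hs : 0 < s) :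
    ∃ (g : E n) (A' : E n →L[ℝ] E n), ⟪g, e⟫ = 1 ∧
      (∀ x, ‖A' x‖ ^ 2 = ‖A (x - ⟪g, x⟫ • e)‖ ^ 2 + (⟪g, x⟫ / s) ^ 2) ∧
      LinearMap.det A'.toLinearMap
        = (1 / (s * ‖A e‖)) * LinearMap.det (A : E n →L[ℝ] E n).toLinearMap := by
  have hAe : A e ≠ 0 := fun h0 => he (by simpa using h0)
  have hk : 0 < ‖A e‖ := norm_pos_iff.2 hAe
  set m : ℝ := 1 / (s * ‖A e‖) with hm
  set g : E n := (‖A e‖ ^ 2)⁻¹ • (ContinuousLinearMap.adjoint (A : E n →L[ℝ] E n)) (A e) with hg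
  have hgx : ∀ x, ⟪g, x⟫ = (‖A e‖ ^ 2)⁻¹ * ⟪A e, A x⟫ := fun x => by
    rw [hg, real_inner_smul_left, ContinuousLinearMap.adjoint_inner_left]
    rfl
  have hge : ⟪g, e⟫ = 1 := by
    rw [hgx, real_inner_self_eq_norm_sq]
    field_simp
  have hcomp : ∀ x, ((A : E n →L[ℝ] E n).comp (ContinuousLinearMap.id ℝ (E n)
      + (m - 1) • (innerSL ℝ g).smulRight e)) x = A (x - ⟪g, x⟫ • e) + (m * ⟪g, x⟫) • A e := by
    intro x
    have : x + (m - 1) • ⟪g, x⟫ • e = (x - ⟪g, x⟫ • e) + (m * ⟪g, x⟫) • e := by module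
    simp only [ContinuousLinearMap.comp_apply, add_apply,
      ContinuousLinearMap.id_apply, smul_apply,
      ContinuousLinearMap.smulRight_apply, innerSL_apply_apply, this]
    simp
  clear_value g
  refine ⟨g, (A : E n →L[ℝ] E n).comp (ContinuousLinearMap.id ℝ (E n)
      + (m - 1) • (innerSL ℝ g).smulRight e), hge, fun x => ?_, ?_⟩
  · rw [hcomp, ← real_inner_self_eq_norm_sq, real_inner_add_add_self,
      real_inner_self_eq_norm_sq, real_inner_self_eq_norm_sq]
    have h1 : ⟪A (x - ⟪g, x⟫ • e), (m * ⟪g, x⟫) • A e⟫ = 0 := by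
      rw [inner_smul_right, map_sub, map_smul, inner_sub_left, real_inner_smul_left,
        real_inner_self_eq_norm_sq, hgx, real_inner_comm]
      field_simp
      ring
    rw [h1, norm_smul, mul_pow, Real.norm_eq_abs, sq_abs, hm]
    field_simp
    ring
  · have h1 : ((A : E n →L[ℝ] E n).comp (ContinuousLinearMap.id ℝ (E n)
        + (m - 1) • (innerSL ℝ g).smulRight e)).toLinearMap
        = (A : E n →L[ℝ] E n).toLinearMap ∘ₗ
          LinearMap.transvection ((m - 1) • (innerSL ℝ g).toLinearMap) e := by
      ext x : 1
      simp [LinearMap.transvection, smul_smul]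
    rw [h1, LinearMap.det_comp, LinearMap.transvection.det]
    have h2 : ((m - 1) • (innerSL ℝ g).toLinearMap) e = m - 1 := by
      simp [hge]
    rw [h2]
    ring

set_option maxHeartbeats 1000000 in
/-- The barrier construction: if the solution lies well below its chord at `se` at the earlier time
`τ'` but not at time `τ`, then a quantitative amount of time has elapsed. -/
lemma barrier_time_bound {Lam p T : ℝ} {Ω : Set (E n)} {u : E n → ℝ → ℝ} (hLam : 0 ≤ Lam)
    (hreg : ParabolicRegular Ω (-T) 0 u) (hsub : ViscSubsolution Lam p Ω (-T) 0 u)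
    {r : ℝ} (hr : closedBall (0 : E n) r ⊆ Ω) {τ τ' : ℝ} (hτ' : -T ≤ τ') (hττ : τ' < τ)
    (hτ : τ ≤ 0) {h s f : ℝ} (hh : 0 < h) (hs : 0 < s) {e v : E n} (he : e ≠ 0)
    (her : 2 * s * ‖e‖ ≤ r) (A : E n ≃L[ℝ] E n) (hA : ∀ x, ‖A x‖ ≤ 1 → ‖x‖ ≤ r)
    (hv : ∀ x, ‖A x‖ ≤ 1 → u x τ ≤ ⟪v, x⟫ + 9 * h)
    (h0 : u 0 τ ≤ 0) (h0' : u 0 τ' ≤ 0) (h2 : u ((2 * s) • e) τ ≤ 2 * s * f)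
    (h2' : u ((2 * s) • e) τ' ≤ 2 * s * f) (h1' : u (s • e) τ' ≤ s * f - 32 * h)
    (hmid : s / 2 * f - 2 * h ≤ u ((s / 2) • e) τ) :
    3 / 2 * h ≤ Lam * ((64 * h) ^ n * ((1 / (s * ‖A e‖)) *
      LinearMap.det (A : E n →L[ℝ] E n).toLinearMap) ^ 2) ^ p * (τ - τ') := by
  obtain ⟨g, A', hge, hA', hdet⟩ := exists_stretch A he hs
  have hcl : closedBall (0 : E n) r ⊆ closure Ω := hr.trans subset_closure
  have hτI : τ ∈ Icc (-T) 0 := ⟨by linarith, hτ⟩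
  have hτI' : τ' ∈ Icc (-T) 0 := ⟨hτ', by linarith⟩
  have hφ : ConvexOn ℝ (closedBall 0 r) (fun x => u x τ) :=
    (hreg.conv τ hτI).subset hcl (convex_closedBall _ _)
  have hφ' : ConvexOn ℝ (closedBall 0 r) (fun x => u x τ') :=
    (hreg.conv τ' hτI').subset hcl (convex_closedBall _ _)
  have hmem : ∀ c : ℝ, 0 ≤ c → c ≤ 2 * s → c • e ∈ closedBall (0 : E n) r := fun c hc hc' => by
    rw [mem_closedBall_zero_iff, norm_smul, Real.norm_of_nonneg hc]
    nlinarith [norm_nonneg e]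
  set z : E n → E n := fun x => x - ⟪g, x⟫ • e with hz
  set W : Set (E n) := {x | 0 ≤ ⟪g, x⟫ ∧ ⟪g, x⟫ ≤ s ∧ ‖A (z x)‖ ≤ 1 / 2} with hW
  set O : Set (E n) := {x | 0 < ⟪g, x⟫ ∧ ⟪g, x⟫ < s ∧ ‖A (z x)‖ < 1 / 2} with hO
  have hgc : Continuous fun x => ⟪g, x⟫ := by fun_prop
  have hAzc : Continuous fun x => ‖A (z x)‖ := by fun_prop
  have hA2z : ∀ x ∈ W, ‖A ((2 : ℝ) • z x)‖ ≤ 1 := fun x hx => by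
    rw [map_smul, norm_smul, Real.norm_of_nonneg zero_le_two]
    linarith [hx.2.2]
  have h2z : ∀ x ∈ W, (2 : ℝ) • z x ∈ closedBall (0 : E n) r := fun x hx => by
    rw [mem_closedBall_zero_iff]
    exact hA _ (hA2z x hx)
  have hdecomp : ∀ x, x = (1 / 2 : ℝ) • (2 * ⟪g, x⟫) • e + (1 / 2 : ℝ) • (2 : ℝ) • z x := by
    intro x
    simp only [hz]
    module
  have hWr : W ⊆ closedBall 0 r := fun x hx => by
    rw [hdecomp x]
    exact convex_closedBall (0 : E n) r (hmem _ (by linarith [hx.1]) (by linarith [hx.2.1]))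
      (h2z x hx) (by norm_num) (by norm_num) (by norm_num)
  have hWc : IsCompact W := by
    refine (isCompact_closedBall (0 : E n) r).of_isClosed_subset ?_ hWr
    exact (isClosed_le continuous_const hgc).inter
      ((isClosed_le hgc continuous_const).inter (isClosed_le hAzc continuous_const))
  have hOo : IsOpen O := by
    exact (isOpen_lt continuous_const hgc).inter
      ((isOpen_lt hgc continuous_const).inter (isOpen_lt hAzc continuous_const))
  have hOW : O ⊆ W := fun x hx => ⟨hx.1.le, hx.2.1.le, hx.2.2.le⟩
  have hhalf : ∀ t : ℝ, ConvexOn ℝ (closedBall 0 r) (fun x => u x t) → ∀ x ∈ W,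
      u x t ≤ (1 / 2) * u ((2 * ⟪g, x⟫) • e) t + (1 / 2) * u ((2 : ℝ) • z x) t := by
    intro t ht x hx
    have := ht.2 (hmem (2 * ⟪g, x⟫) (by linarith [hx.1]) (by linarith [hx.2.1])) (h2z x hx)
      (show (0 : ℝ) ≤ 1 / 2 by norm_num) (show (0 : ℝ) ≤ 1 / 2 by norm_num) (by norm_num)
    simp only [← hdecomp x] at this
    exact this
  have hvz : ∀ x ∈ W, u ((2 : ℝ) • z x) τ ≤ 2 * ⟪v, z x⟫ + 9 * h := fun x hx => by
    have := hv _ (hA2z x hx)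
    rwa [inner_smul_right] at this
  have hvz' : ∀ x ∈ W, u ((2 : ℝ) • z x) τ' ≤ 2 * ⟪v, z x⟫ + 9 * h := fun x hx =>
    (hreg.mono _ (hcl (h2z x hx)) τ' hτI' τ hτI hττ.le).trans (hvz x hx)
  set w : E n := f • g + v - ⟪v, e⟫ • g with hw
  have hwx : ∀ x, ⟪w, x⟫ = f * ⟪g, x⟫ + ⟪v, z x⟫ := fun x => by
    simp only [hw, hz, inner_sub_left, inner_add_left, real_inner_smul_left, inner_sub_right,
      inner_smul_right]
    ring
  have hseg : ∀ (t : ℝ), ConvexOn ℝ (closedBall 0 r) (fun x => u x t) → ∀ c₁ c₂ a b : ℝ,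
      0 ≤ c₁ → c₁ ≤ 2 * s → 0 ≤ c₂ → c₂ ≤ 2 * s → 0 ≤ a → 0 ≤ b → a + b = 1 →
      u ((a * c₁ + b * c₂) • e) t ≤ a * u (c₁ • e) t + b * u (c₂ • e) t := by
    intro t ht c₁ c₂ a b h₁ h₂ h₃ h₄ ha hb hab
    have := ht.2 (hmem c₁ h₁ h₂) (hmem c₂ h₃ h₄) ha hb hab
    rwa [smul_smul, smul_smul, ← add_smul] at this
  have hquad : ∀ x, ‖A' (x - (s / 2) • e)‖ ^ 2
      = ‖A (z x)‖ ^ 2 + (⟪g, x⟫ / s - 1 / 2) ^ 2 := fun x => by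
    rw [hA', inner_sub_right, inner_smul_right, hge]
    have h3 : x - (s / 2) • e - (⟪g, x⟫ - s / 2 * 1) • e = z x := by
      simp only [hz]
      module
    rw [h3]
    field_simp
  have key := subsolution_le_quadratic hLam hreg hsub hWc (hWr.trans hr) hOo hOW hτ' hττ hτ
    (a := -(7 / 2 * h)) (b := 32 * h) w ((s / 2) • e) A' (by positivity) ?_ ?_ ((s / 2) • e) ?_
  · rw [hwx, sub_self, inner_smul_right, hge, hdet] at key
    have h3 : z ((s / 2) • e) = 0 := by
      simp only [hz, inner_smul_right, hge]
      module
    rw [h3] at key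
    simp only [inner_zero_right, map_zero, norm_zero] at key
    have h4 : 2 * (32 * h) = 64 * h := by ring
    rw [h4] at key
    linarith
  · intro x hx
    rw [hquad, hwx]
    set α := ⟪g, x⟫ / s with hα
    have hαs : ⟪g, x⟫ = α * s := by rw [hα]; field_simp
    have hα0 : 0 ≤ α := div_nonneg hx.1 hs.le
    have hα1 : α ≤ 1 := (div_le_one hs).2 hx.2.1
    have h3 := hhalf τ' hφ' x hx
    have h4 := hvz' x hx
    have h5 : 0 ≤ 32 * h * ‖A (z x)‖ ^ 2 := by positivity
    have h6 : u ((2 * ⟪g, x⟫) • e) τ' ≤ 2 * (f * ⟪g, x⟫) - 64 * h * (α * (1 - α)) := by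
      rcases le_total α (1 / 2) with h7 | h7
      · have h8 := hseg τ' hφ' s 0 (2 * α) (1 - 2 * α) hs.le (by linarith) le_rfl (by linarith)
          (by linarith) (by linarith) (by ring)
        have h9 : 2 * α * s + (1 - 2 * α) * 0 = 2 * ⟪g, x⟫ := by rw [hαs]; ring
        rw [h9, zero_smul] at h8
        have h10 := mul_le_mul_of_nonneg_left h1' (show 0 ≤ 2 * α by linarith)
        have h11 := mul_nonpos_of_nonneg_of_nonpos (show 0 ≤ 1 - 2 * α by linarith) h0'
        have h12 : 0 ≤ 64 * h * α ^ 2 := by positivity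
        rw [hαs] at h8 ⊢
        nlinarith
      · have h8 := hseg τ' hφ' s (2 * s) (2 - 2 * α) (2 * α - 1) hs.le (by linarith)
          (by linarith) le_rfl (by linarith) (by linarith) (by ring)
        have h9 : (2 - 2 * α) * s + (2 * α - 1) * (2 * s) = 2 * ⟪g, x⟫ := by rw [hαs]; ring
        rw [h9] at h8
        have h10 := mul_le_mul_of_nonneg_left h1' (show 0 ≤ 2 - 2 * α by linarith)
        have h11 := mul_le_mul_of_nonneg_left h2' (show 0 ≤ 2 * α - 1 by linarith)
        have h12 : 0 ≤ 64 * h * (1 - α) ^ 2 := by positivity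
        rw [hαs] at h8 ⊢
        nlinarith
    nlinarith
  · intro x hx hxO
    rw [hquad, hwx]
    set α := ⟪g, x⟫ / s with hα
    have hαs : ⟪g, x⟫ = α * s := by rw [hα]; field_simp
    have hα0 : 0 ≤ α := div_nonneg hx.1 hs.le
    have hα1 : α ≤ 1 := (div_le_one hs).2 hx.2.1
    have h3 := hhalf τ hφ x hx
    have h4 := hvz x hx
    have h6 : u ((2 * ⟪g, x⟫) • e) τ ≤ 2 * (f * ⟪g, x⟫) := by
      have h8 := hseg τ hφ (2 * s) 0 α (1 - α) (by linarith) le_rfl le_rfl (by linarith)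
        (by linarith) (by linarith) (by ring)
      have h9 : α * (2 * s) + (1 - α) * 0 = 2 * ⟪g, x⟫ := by rw [hαs]; ring
      rw [h9, zero_smul] at h8
      have h10 := mul_le_mul_of_nonneg_left h2 hα0
      have h11 := mul_nonpos_of_nonneg_of_nonpos (show 0 ≤ 1 - α by linarith) h0
      rw [hαs] at h8 ⊢
      nlinarith
    have h7 : 1 / 4 ≤ ‖A (z x)‖ ^ 2 + (α - 1 / 2) ^ 2 := by
      by_contra! hlt
      have hb : ‖A (z x)‖ < 1 / 2 := by
        nlinarith [norm_nonneg (A (z x)), sq_nonneg (α - 1 / 2)]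
      have hα2 : 0 < α * (1 - α) := by nlinarith [sq_nonneg ‖A (z x)‖]
      refine hxO ⟨?_, ?_, hb⟩
      · rw [hαs]
        exact mul_pos (lt_of_le_of_ne hα0 fun h => by rw [← h] at hα2; linarith) hs
      · rw [hαs]
        have : α < 1 := lt_of_le_of_ne hα1 fun h => by rw [h] at hα2; linarith
        nlinarith
    nlinarith
  · have h3 : z ((s / 2) • e) = 0 := by
      simp only [hz, inner_smul_right, hge]
      module
    refine ⟨?_, ?_, ?_⟩
    · rw [inner_smul_right, hge]; linarith
    · rw [inner_smul_right, hge]; linarith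
    · rw [h3]; simp

lemma ConvexOn.chord_sub_le {φ : E n → ℝ} {r : ℝ} (hφ : ConvexOn ℝ (closedBall 0 r) φ)
    {s h : ℝ} (hs : 0 < s) (hh : 0 ≤ h) {e : E n} (her : 2 * s * ‖e‖ ≤ r)
    (hmid : φ ((2 * s) • e) / 2 - h ≤ φ (s • e)) {a : ℝ} (ha : 0 ≤ a) (has : a ≤ s) :
    a * (φ ((2 * s) • e) / (2 * s)) - 2 * h ≤ φ (a • e) := by
  have hmem : ∀ c : ℝ, 0 ≤ c → c ≤ 2 * s → c • e ∈ closedBall (0 : E n) r := fun c hc hc' => by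
    rw [mem_closedBall_zero_iff, norm_smul, Real.norm_of_nonneg hc]
    nlinarith [norm_nonneg e]
  have hd : 0 < 2 * s - a := by linarith
  have hd' : 2 * s - a ≠ 0 := hd.ne'
  have h1 := hφ.2 (hmem a ha (by linarith)) (hmem (2 * s) (by linarith) le_rfl)
    (div_nonneg hs.le hd.le) (div_nonneg (sub_nonneg.2 has) hd.le)
    (by rw [← add_div, div_eq_one_iff_eq hd']; ring)
  rw [smul_smul, smul_smul, ← add_smul] at h1
  have h2 : s / (2 * s - a) * a + (s - a) / (2 * s - a) * (2 * s) = s := by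
    rw [div_mul_eq_mul_div, div_mul_eq_mul_div, ← add_div, div_eq_iff hd']
    ring
  rw [h2, smul_eq_mul, smul_eq_mul] at h1
  set f := φ ((2 * s) • e) / (2 * s) with hf
  have hf' : φ ((2 * s) • e) = 2 * s * f := by rw [hf]; field_simp
  rw [hf'] at h1 hmid
  have h3 : (2 * s - a) * (s * f - h) ≤ s * φ (a • e) + (s - a) * (2 * s * f) := by
    have h4 := mul_le_mul_of_nonneg_left (hmid.trans h1) hd.le
    have h5 : (2 * s - a) * (s / (2 * s - a) * φ (a • e) + (s - a) / (2 * s - a) * (2 * s * f))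
        = s * φ (a • e) + (s - a) * (2 * s * f) := by field_simp
    rw [h5] at h4
    linarith
  have h6 : s * (a * f - 2 * h) ≤ s * φ (a • e) := by nlinarith
  exact le_of_mul_le_mul_left h6 hs

/-- The symmetrized difference quotient of `u` at `0` in direction `e`. -/
def symmSlope (u : E n → ℝ → ℝ) (e : E n) (s t : ℝ) : ℝ :=
  (u (s • e) t + u (s • (-e)) t) / (2 * s)

set_option maxHeartbeats 1000000 in
/-- If the slope at time `τ` hardly changes between the scales `s` and `2s`, then it was not much
smaller at an earlier time `τ'`, unless `τ'` is much larger than `τ`. -/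
lemma lt_symmSlope_of_lt {lam Lam p T : ℝ} {Ω : Set (E n)} {u : E n → ℝ → ℝ} (hn : 1 ≤ n)
    (hp : 0 < p) (hlam : 0 < lam) (hLam : 0 < Lam) (hreg : ParabolicRegular Ω (-T) 0 u)
    (hsub : ViscSubsolution Lam p Ω (-T) 0 u) (hsup : ViscSupersolution lam p Ω (-T) 0 u)
    (hu00 : u 0 0 = 0) {r ε ρ h₀ τ₀ : ℝ} (hr0 : 0 < r) (hr : closedBall (0 : E n) r ⊆ Ω)
    (hρ : ρ = 2 * (n + 2) * ((n : ℝ) ^ 2 + 1)) (hε : 2 * ρ * ε ≤ r)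
    (hsec : ∀ τ ∈ Icc (-τ₀) 0, ∀ x : E n, ‖x‖ ≤ r → u x τ + u (-x) τ ≤ 6 * h₀ → ‖x‖ < ε)
    {e : E n} (he : e ≠ 0) {s τ τ' K ω : ℝ} (hω : 0 < ω) (hK : 10 / ω < K) (hs : 0 < s)
    (hsh : s / K ≤ h₀) (her : 2 * s * ‖e‖ ≤ r) (hτ₀ : -τ₀ ≤ τ) (hτ : τ < 0) (hτ' : -T ≤ τ')
    (hττ : τ' < τ) (hF : ω / 2 ≤ symmSlope u e (2 * s) τ)
    (hF' : symmSlope u e (2 * s) τ - 1 / (2 * K) < symmSlope u e s τ)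
    (htime : Lam * ((128 * ρ ^ 2) ^ n * (10 / (K * ω)) ^ 2) ^ p * (9 + 28 * ρ) * (-τ')
      ≤ lam * (-τ)) :
    symmSlope u e (2 * s) τ - 32 / K < symmSlope u e s τ' := by
  have hK0 : 0 < K := lt_trans (by positivity) hK
  have hρ0 : 0 < ρ := by rw [hρ]; positivity
  set h := s / K with hh_def
  have hh : 0 < h := by positivity
  have hcl : closedBall (0 : E n) r ⊆ closure Ω := hr.trans subset_closure
  have hτI : τ ∈ Icc (-T) 0 := ⟨by linarith, hτ.le⟩
  have hτI' : τ' ∈ Icc (-T) 0 := ⟨hτ', by linarith⟩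
  have h0I : (0 : ℝ) ∈ Icc (-T) 0 := ⟨by linarith, le_rfl⟩
  have hφ : ConvexOn ℝ (closedBall 0 r) (fun x => u x τ) :=
    (hreg.conv τ hτI).subset hcl (convex_closedBall _ _)
  have hφc : ContinuousOn (fun x => u x τ) (closedBall 0 r) :=
    hreg.cont.comp (f := fun x : E n => (x, τ)) (by fun_prop) fun x hx => ⟨hcl hx, hτI⟩
  have h0r : (0 : E n) ∈ closedBall (0 : E n) r := by simp [hr0.le]
  have hφ0 : u 0 τ ≤ 0 := hu00 ▸ hreg.mono 0 (hcl h0r) τ hτI 0 h0I hτ.le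
  have hφ0' : u 0 τ' ≤ 0 := hu00 ▸ hreg.mono 0 (hcl h0r) τ' hτI' 0 h0I (by linarith)
  have hern : 2 * s * ‖-e‖ ≤ r := by rwa [norm_neg]
  have hhalf : ∀ e' : E n, 2 * s * ‖e'‖ ≤ r →
      u (s • e') τ ≤ u 0 τ / 2 + u ((2 * s) • e') τ / 2 := fun e' he' => by
    have h1 : (2 * s) • e' ∈ closedBall (0 : E n) r := by
      rw [mem_closedBall_zero_iff, norm_smul, Real.norm_of_nonneg (by positivity)]
      exact he'
    have h2 := hφ.2 h0r h1 (show (0 : ℝ) ≤ 1 / 2 by norm_num) (show (0 : ℝ) ≤ 1 / 2 by norm_num)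
      (by norm_num)
    have h3 : (1 / 2 : ℝ) * (2 * s) = s := by ring
    rw [smul_zero, zero_add, smul_smul, h3, smul_eq_mul, smul_eq_mul] at h2
    linarith
  have hsum : (u ((2 * s) • e) τ + u ((2 * s) • (-e)) τ) / 2 - h
      < u (s • e) τ + u (s • (-e)) τ := by
    simp only [symmSlope] at hF'
    have h1 := mul_lt_mul_of_pos_left hF' (show 0 < 2 * s by positivity)
    have h2 : 2 * s * ((u ((2 * s) • e) τ + u ((2 * s) • (-e)) τ) / (2 * (2 * s)) - 1 / (2 * K))
        = (u ((2 * s) • e) τ + u ((2 * s) • (-e)) τ) / 2 - h := by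
      rw [hh_def]; field_simp
    have h3 : 2 * s * ((u (s • e) τ + u (s • (-e)) τ) / (2 * s))
        = u (s • e) τ + u (s • (-e)) τ := by field_simp
    rwa [h2, h3] at h1
  have hmid₁ : u ((2 * s) • e) τ / 2 - h ≤ u (s • e) τ := by linarith [hhalf _ hern]
  have hmid₂ : u ((2 * s) • (-e)) τ / 2 - h ≤ u (s • (-e)) τ := by linarith [hhalf _ her]
  have hφ0h : -(2 * h) ≤ u 0 τ := by linarith [hhalf _ her, hhalf _ hern]
  have hc₁ : ∀ a : ℝ, 0 ≤ a → a ≤ s → _ := fun a ha has =>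
    hφ.chord_sub_le hs hh.le her hmid₁ ha has
  have hc₂ : ∀ a : ℝ, 0 ≤ a → a ≤ s → _ := fun a ha has =>
    hφ.chord_sub_le hs hh.le hern hmid₂ ha has
  set f₁ := u ((2 * s) • e) τ / (2 * s) with hf₁
  set f₂ := u ((2 * s) • (-e)) τ / (2 * s) with hf₂
  have hf₁' : u ((2 * s) • e) τ = 2 * s * f₁ := by rw [hf₁]; field_simp
  have hf₂' : u ((2 * s) • (-e)) τ = 2 * s * f₂ := by rw [hf₂]; field_simp
  have hff : symmSlope u e (2 * s) τ = (f₁ + f₂) / 2 := by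
    rw [symmSlope, hf₁', hf₂']; field_simp
  have hωf : ω ≤ f₁ + f₂ := by rw [hff] at hF; linarith
  obtain ⟨A, v, v', hA1, hA2, hA3, hA4, hA5⟩ := exists_section_normalization hn hr0 hh hφ hφc hφ0
    hφ0h (fun x hx hx' => hsec τ ⟨hτ₀, hτ.le⟩ x hx (by linarith)) hρ hε
  set D := LinearMap.det (A : E n →L[ℝ] E n).toLinearMap with hD
  have hsuper := supersolution_time_bound hlam.le hp hreg hsup (A : E n →L[ℝ] E n) hρ0
    ((isCompact_closedBall (0 : E n) r).of_isClosed_subset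
      (isClosed_le (by fun_prop) continuous_const)
      fun x hx => by rw [mem_closedBall_zero_iff]; exact hA3 x hx)
    (fun x hx => hr (by rw [mem_closedBall_zero_iff]; exact hA3 x hx)) hτI.1 hτ le_rfl
    (a := 2 * h) (c := h) (d := (5 + 14 * ρ) * h) v' hh (by nlinarith)
    (fun x hx hx' => hA4 x hx hx') (fun x hx => hA5 x hx) (by rw [hu00]; linarith)
  have hk : 0 < ‖A e‖ := norm_pos_iff.2 fun h0 => he (by simpa using h0)
  have hAe : ω / (10 * h) ≤ ‖A e‖ := by
    have hneg : ∀ t : ℝ, -(t • e) = t • (-e) := fun t => (smul_neg t e).symm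
    by_contra! hlt
    have h2 : 10 * h < ‖A e‖⁻¹ * ω := by
      rw [lt_inv_mul_iff₀ hk]
      rw [lt_div_iff₀ (by positivity)] at hlt
      exact hlt
    have h3 : 10 * h < s * ω := by
      rw [hh_def]
      rw [div_lt_iff₀ hω] at hK
      rw [← mul_div_assoc, div_lt_iff₀ hK0]
      nlinarith
    set a := min s ‖A e‖⁻¹ with ha
    have ha0 : 0 ≤ a := le_min hs.le (inv_nonneg.2 hk.le)
    have h4 : 10 * h < a * ω := by
      rcases min_choice s ‖A e‖⁻¹ with h | h <;> rw [ha, h] <;> assumption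
    have h5 := (hA1 (a • e) (by
      rw [map_smul, norm_smul, Real.norm_of_nonneg ha0]
      calc a * ‖A e‖ ≤ ‖A e‖⁻¹ * ‖A e‖ := by gcongr; exact min_le_right _ _
        _ = 1 := inv_mul_cancel₀ hk.ne')).2.2
    rw [hneg] at h5
    have h6 := hc₁ a ha0 (min_le_left _ _)
    have h7 := hc₂ a ha0 (min_le_left _ _)
    have h8 := mul_le_mul_of_nonneg_left hωf ha0
    linarith
  have hm : 1 / (s * ‖A e‖) ≤ 10 / (K * ω) := by
    rw [div_le_div_iff₀ (by positivity) (by positivity)]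
    rw [div_le_iff₀ (by positivity), hh_def] at hAe
    have : ω * K ≤ ‖A e‖ * (10 * s) := by
      have h1 := mul_le_mul_of_nonneg_right hAe hK0.le
      have h2 : ‖A e‖ * (10 * (s / K)) * K = ‖A e‖ * (10 * s) := by field_simp
      rwa [h2] at h1
    linarith
  set Y := (2 * (h / (4 * ρ ^ 2))) ^ n * D ^ 2 with hY
  have hY0 : 0 ≤ Y := by positivity
  have hX : ((64 * h) ^ n * ((1 / (s * ‖A e‖)) * D) ^ 2) ^ p
      ≤ ((128 * ρ ^ 2) ^ n * (10 / (K * ω)) ^ 2) ^ p * Y ^ p := by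
    rw [← Real.mul_rpow (by positivity) hY0]
    refine Real.rpow_le_rpow (by positivity) ?_ hp.le
    have h1 : 64 * h = 128 * ρ ^ 2 * (2 * (h / (4 * ρ ^ 2))) := by field_simp; ring
    calc (64 * h) ^ n * ((1 / (s * ‖A e‖)) * D) ^ 2
        = (64 * h) ^ n * D ^ 2 * (1 / (s * ‖A e‖)) ^ 2 := by ring
      _ ≤ (64 * h) ^ n * D ^ 2 * (10 / (K * ω)) ^ 2 := by gcongr
      _ = _ := by rw [h1, mul_pow, hY]; ring
  set Q := ((128 * ρ ^ 2) ^ n * (10 / (K * ω)) ^ 2) ^ p with hQ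
  have hQ0 : 0 ≤ Q := by positivity
  have hside : ∀ e' : E n, e' ≠ 0 → 2 * s * ‖e'‖ ≤ r → ‖A e'‖ = ‖A e‖ → ∀ f : ℝ,
      u ((2 * s) • e') τ = 2 * s * f → s / 2 * f - 2 * h ≤ u ((s / 2) • e') τ →
      s * f - 32 * h < u (s • e') τ' := by
    intro e' he' he'r hAe' f hf hf'
    by_contra! hle
    have h1 : (2 * s) • e' ∈ closure Ω := hcl (by
      rw [mem_closedBall_zero_iff, norm_smul, Real.norm_of_nonneg (by positivity)]
      exact he'r)
    have h2 := barrier_time_bound hLam.le hreg hsub hr hτ' hττ hτ.le hh hs he' he'r A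
      (fun x hx => (hA1 x hx).1) hA2 hφ0 hφ0' hf.le
      ((hreg.mono _ h1 τ' hτI' τ hτI hττ.le).trans hf.le) hle hf'
    rw [hAe'] at h2
    have h3 : 3 / 2 * h ≤ Lam * (Q * Y ^ p) * (-τ') := by
      refine h2.trans ?_
      have h4 : τ - τ' ≤ -τ' := by linarith
      have h5 : 0 ≤ τ - τ' := by linarith
      gcongr
    have h6 : 0 ≤ Y ^ p := Real.rpow_nonneg hY0 p
    have h7 : 3 / 2 * h * (9 + 28 * ρ) ≤ Lam * (Q * Y ^ p) * (-τ') * (9 + 28 * ρ) := by gcongr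
    have h8 := mul_le_mul_of_nonneg_right htime h6
    have h9 : (0 - τ) * (lam * Y ^ p) ≤ 2 * ((5 + 14 * ρ) * h) - h := hsuper
    have h10 : 0 < h * ρ := by positivity
    nlinarith
  have h₁ := hside e he her rfl f₁ hf₁' (hc₁ (s / 2) (by positivity) (by linarith))
  have h₂ := hside (-e) (neg_ne_zero.2 he) hern (by rw [map_neg, norm_neg]) f₂ hf₂'
    (hc₂ (s / 2) (by positivity) (by linarith))
  rw [hff, symmSlope, lt_div_iff₀ (by positivity)]
  have h3 : ((f₁ + f₂) / 2 - 32 / K) * (2 * s) = s * (f₁ + f₂) - 64 * h := by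
    rw [hh_def]; field_simp; ring
  rw [h3]
  linarith

/-- An interior Hölder estimate in time. -/
lemma exists_holder_const {Lam p T : ℝ} {Ω : Set (E n)} {u : E n → ℝ → ℝ} (hLam : 0 ≤ Lam)
    (hreg : ParabolicRegular Ω (-T) 0 u) (hsub : ViscSubsolution Lam p Ω (-T) 0 u)
    {r : ℝ} (hr0 : 0 < r) (hr : closedBall (0 : E n) r ⊆ Ω) :
    ∃ C, ∀ x₀ : E n, ‖x₀‖ ≤ r / 2 → ∀ τ, -T ≤ τ → τ < 0 → u x₀ τ < u x₀ 0 →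
      (u x₀ 0 - u x₀ τ) * ((u x₀ 0 - u x₀ τ) ^ n) ^ p ≤ C * (-τ) := by
  have hcl : closedBall (0 : E n) r ⊆ closure Ω := hr.trans subset_closure
  obtain ⟨M₀, hM₀⟩ := ((isCompact_closedBall (0 : E n) r).prod
    (isCompact_Icc (a := -T) (b := 0))).exists_bound_of_continuousOn
    (hreg.cont.mono (prod_mono hcl le_rfl))
  set M := max M₀ 1 with hM_def
  have hM0 : 0 < M := lt_of_lt_of_le one_pos (le_max_right _ _)
  have hM : ∀ x : E n, ‖x‖ ≤ r → ∀ t ∈ Icc (-T) 0, |u x t| ≤ M := fun x hx t ht =>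
    (hM₀ (x, t) ⟨by simpa using hx, ht⟩).trans (le_max_left _ _)
  set R := r / 2 with hR
  have hR0 : 0 < R := by positivity
  set L := 2 * M / R with hL
  have hL0 : 0 < L := by positivity
  refine ⟨2 * Lam * ((2 * L ^ 2) ^ n) ^ p, fun x₀ hx₀ τ hτ hτ0 hlt => ?_⟩
  set d := u x₀ 0 - u x₀ τ with hd
  have hd0 : 0 < d := sub_pos.2 hlt
  have hτI : τ ∈ Icc (-T) 0 := ⟨hτ, hτ0.le⟩
  have h0I : (0 : ℝ) ∈ Icc (-T) 0 := ⟨by linarith, le_rfl⟩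
  have hin : ∀ x, ‖x - x₀‖ ≤ R → ‖x‖ ≤ r := fun x hx => by
    have := norm_add_le (x - x₀) x₀
    rw [sub_add_cancel] at this
    linarith
  have hx₀r : ‖x₀‖ ≤ r := by linarith
  have hdM : d ≤ 2 * M := by
    have h1 := abs_le.1 (hM x₀ hx₀r τ hτI)
    have h2 := abs_le.1 (hM x₀ hx₀r 0 h0I)
    linarith
  have hlip : ∀ x, ‖x - x₀‖ ≤ R → u x τ ≤ u x₀ τ + L * ‖x - x₀‖ := by
    intro x hx
    rcases eq_or_ne x x₀ with rfl | hne
    · simp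
    have hk : 0 < ‖x - x₀‖ := norm_pos_iff.2 (sub_ne_zero.2 hne)
    set y := x₀ + (R / ‖x - x₀‖) • (x - x₀) with hy
    have hyr : ‖y‖ ≤ r := hin y <| by
      rw [hy, add_sub_cancel_left, norm_smul, Real.norm_of_nonneg (by positivity),
        div_mul_cancel₀ _ hk.ne']
    set θ := ‖x - x₀‖ / R with hθ
    have hθ0 : 0 ≤ θ := by positivity
    have hθ1 : θ ≤ 1 := (div_le_one hR0).2 hx
    have h1 := (hreg.conv τ hτI).2 (hcl (show x₀ ∈ closedBall (0 : E n) r by simpa using hx₀r))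
      (hcl (show y ∈ closedBall (0 : E n) r by simpa using hyr)) (sub_nonneg.2 hθ1) hθ0 (by ring)
    have h2 : (1 - θ) • x₀ + θ • y = x := by
      have h3 : θ * (R / ‖x - x₀‖) = 1 := by rw [hθ]; field_simp
      rw [hy, smul_add, smul_smul, h3]
      module
    rw [h2, smul_eq_mul, smul_eq_mul] at h1
    have h4 := abs_le.1 (hM y hyr τ hτI)
    have h5 := abs_le.1 (hM x₀ hx₀r τ hτI)
    have h6 : θ * (u y τ - u x₀ τ) ≤ θ * (2 * M) := by gcongr; linarith
    have h7 : L * ‖x - x₀‖ = θ * (2 * M) := by rw [hL, hθ]; field_simp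
    rw [h7]
    linarith
  have key := subsolution_le_quadratic hLam hreg hsub (isCompact_closedBall x₀ R)
    (fun x hx => hr (by simpa using hin x (by simpa [dist_eq_norm] using hx)))
    (isOpen_ball (x := x₀) (ε := R)) ball_subset_closedBall hτ hτ0 le_rfl
    (a := u x₀ τ + d / 2) (b := L ^ 2 / d) 0 x₀ (ContinuousLinearMap.id ℝ (E n))
    (by positivity) ?_ ?_ x₀ (by simp [hR0.le])
  · have h1 : LinearMap.det (ContinuousLinearMap.id ℝ (E n)).toLinearMap = 1 := by simp
    rw [h1] at key
    simp only [inner_zero_left, sub_self, map_zero, norm_zero, one_pow, mul_one] at key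
    have h2 : 2 * (L ^ 2 / d) = 2 * L ^ 2 / d := by ring
    have h3 : d / 2 ≤ Lam * (((2 * L ^ 2) ^ n) ^ p / (d ^ n) ^ p) * (-τ) := by
      rw [← Real.div_rpow (by positivity) (by positivity), ← div_pow, ← h2]
      linarith
    have h4 : 0 < (d ^ n) ^ p := by positivity
    have h5 : Lam * (((2 * L ^ 2) ^ n) ^ p / (d ^ n) ^ p) * (-τ) * (d ^ n) ^ p
        = Lam * ((2 * L ^ 2) ^ n) ^ p * (-τ) := by field_simp
    have h6 := mul_le_mul_of_nonneg_right h3 h4.le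
    rw [h5] at h6
    linarith
  · intro x hx
    have h1 := hlip x (by simpa [dist_eq_norm] using hx)
    simp only [inner_zero_left, ContinuousLinearMap.id_apply]
    have h2 : L * ‖x - x₀‖ ≤ d / 2 + L ^ 2 / d * ‖x - x₀‖ ^ 2 := by
      have h3 : d / 2 + L ^ 2 / d * ‖x - x₀‖ ^ 2 - L * ‖x - x₀‖
          = ((d - L * ‖x - x₀‖) ^ 2 + (L * ‖x - x₀‖) ^ 2) / (2 * d) := by
        field_simp
        ring
      have h4 : 0 ≤ ((d - L * ‖x - x₀‖) ^ 2 + (L * ‖x - x₀‖) ^ 2) / (2 * d) := by positivity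
      linarith
    linarith
  · intro x hx hx'
    have hxR : ‖x - x₀‖ = R := by
      rw [mem_closedBall, dist_eq_norm] at hx
      rw [mem_ball, dist_eq_norm, not_lt] at hx'
      exact le_antisymm hx hx'
    simp only [inner_zero_left, ContinuousLinearMap.id_apply, hxR]
    have h1 : 2 * M ≤ L ^ 2 / d * R ^ 2 := by
      rw [hL, div_pow, div_mul_eq_mul_div, div_mul_cancel₀ _ (by positivity),
        le_div_iff₀ hd0]
      nlinarith
    have h4 := abs_le.1 (hM x (hin x hxR.le) 0 h0I)
    have h5 := abs_le.1 (hM x₀ hx₀r τ hτI)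
    linarith

/-- The discrete decay argument: a two-parameter family which is small at the initial time and
satisfies a one-step comparison stays strictly below its limit along a diagonal. -/
lemma exists_diagonal_gap {G : ℕ → ℕ → ℝ} {ω c d₀ : ℝ} (hω : 0 < ω) (hc : 0 < c) (hd₀ : 0 < d₀)
    (hmono : ∀ i k, G (i + 1) k ≤ G i k) (htop : ∀ k, G 0 k ≤ ω + c / 4)
    (hinit : ∀ i, G i 0 ≤ ω - c / 4)
    (hstep : ∀ i k d, 0 < d → d ≤ d₀ → ω / 2 ≤ G i (k + 1) → G i (k + 1) - d < G (i + 1) (k + 1) →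
      G i (k + 1) - 64 * d < G (i + 1) k) :
    ∃ δ > 0, ∃ i₁ : ℕ, ∀ k, G (i₁ + 128 * k) k ≤ ω - δ := by
  set δ := min (c / 4) (ω / 2) with hδ
  have hδ0 : 0 < δ := by positivity
  have hδc : δ ≤ c / 4 := min_le_left _ _
  have hδω : δ ≤ ω / 2 := min_le_right _ _
  set M := δ + c / 4 with hM
  have hM0 : 0 < M := by positivity
  set γ := min (1 / 128) (d₀ / M) with hγ
  have hγ0 : 0 < γ := by positivity
  have hγ1 : γ ≤ 1 / 128 := min_le_left _ _
  have hγM : γ * M ≤ d₀ := (le_div_iff₀ hM0).1 (min_le_right _ _)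
  obtain ⟨X, hX⟩ : ∃ X, X = 1 + γ := ⟨_, rfl⟩
  have hX1 : 1 < X := by linarith
  set y := X⁻¹ with hy
  have hy0 : 0 < y := by positivity
  have hy1 : y < 1 := inv_lt_one_of_one_lt₀ hX1
  have hyx : y * X = 1 := inv_mul_cancel₀ (by positivity)
  set B : ℕ → ℕ → ℝ := fun i k => M * X ^ (128 * k) * y ^ i with hB
  have hBpos : ∀ i k, 0 < B i k := fun i k => by positivity
  have hBi : ∀ i k, B i k = B (i + 1) k * X := fun i k => by
    simp only [hB, pow_succ]
    linear_combination (-(M * X ^ (128 * k) * y ^ i)) * hyx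
  have hBk : ∀ i k, B i k ≤ B i (k + 1) * (1 - 64 * γ) := fun i k => by
    have h1 : B i (k + 1) = B i k * X ^ 128 := by
      simp only [hB, mul_add, pow_add]
      ring
    have h2 : 1 + (128 : ℕ) * γ ≤ X ^ 128 :=
      hX ▸ one_add_mul_le_pow (by linarith) 128
    have h3 : 1 ≤ X ^ 128 * (1 - 64 * γ) := by
      push_cast at h2
      have h4 := mul_le_mul_of_nonneg_right h2 (show 0 ≤ 1 - 64 * γ by linarith)
      have h5 : 0 ≤ γ * (1 / 128 - γ) := mul_nonneg hγ0.le (by linarith)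
      have h6 : (1 + 128 * γ) * (1 - 64 * γ) = 1 + 8192 * (γ * (1 / 128 - γ)) := by ring
      linarith only [h4, h5, h6]
    rw [h1, mul_assoc]
    exact le_mul_of_one_le_right (hBpos i k).le h3
  have hanti : ∀ i k, G i k ≤ ω + c / 4 := fun i k => by
    induction i with
    | zero => exact htop k
    | succ i ih => exact (hmono i k).trans ih
  have main : ∀ k i, G i k ≤ ω - δ + B i k := by
    intro k
    induction k with
    | zero => exact fun i => by linarith [hinit i, hBpos i 0]
    | succ k ihk =>
      intro i
      induction i with
      | zero =>
        have h1 : M ≤ B 0 (k + 1) := by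
          simp only [hB, pow_zero, mul_one]
          exact le_mul_of_one_le_right hM0.le (one_le_pow₀ hX1.le)
        linarith [htop (k + 1)]
      | succ i ihi =>
        by_contra! hlt
        have h1 := hanti (i + 1) (k + 1)
        have hBp := hBpos (i + 1) (k + 1)
        have h2 : B (i + 1) (k + 1) < M := by linarith
        rw [hBi, hX] at ihi
        have h3 := hmono i (k + 1)
        have h4 := hstep i k (γ * B (i + 1) (k + 1)) (by positivity)
          ((mul_le_mul_of_nonneg_left h2.le hγ0.le).trans hγM) (by linarith) (by linarith)
        have h5 := ihk (i + 1)
        have h6 := hBk (i + 1) k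
        linarith
  obtain ⟨i₁, hi₁⟩ := exists_pow_lt_of_lt_one (show 0 < δ / 2 / M by positivity) hy1
  refine ⟨δ / 2, by positivity, i₁, fun k => ?_⟩
  have h1 := main k (i₁ + 128 * k)
  have h2 : B (i₁ + 128 * k) k = M * y ^ i₁ := by
    simp only [hB]
    rw [pow_add]
    have : X ^ (128 * k) * y ^ (128 * k) = 1 := by
      rw [← mul_pow, mul_comm, hyx, one_pow]
    linear_combination (M * y ^ i₁) * this
  rw [lt_div_iff₀ hM0] at hi₁
  rw [h2] at h1
  linarith

lemma tendsto_mul_rpow_atTop_zero {a b c ω p : ℝ} (hp : 0 < p) (n : ℕ) :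
    Filter.Tendsto (fun K : ℝ => a * (b ^ n * (10 / (K * ω)) ^ 2) ^ p * c) Filter.atTop
      (nhds 0) := by
  have h1 : Filter.Tendsto (fun K : ℝ => 10 / (K * ω)) Filter.atTop (nhds 0) := by
    have h2 : (fun K : ℝ => 10 / (K * ω)) = fun K => 10 / ω * K⁻¹ := by
      funext K
      rw [div_eq_mul_inv, mul_inv, div_eq_mul_inv]
      ring
    rw [h2]
    simpa using tendsto_inv_atTop_zero.const_mul (10 / ω)
  have h3 := (((h1.pow 2).const_mul (b ^ n)).rpow_const (p := p) (Or.inr hp.le)).const_mul a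
  have h4 := h3.mul_const c
  simpa [Real.zero_rpow hp.ne'] using h4

/-- A point violating a strict inequality against `|x_N|` can be moved off the hyperplane
`x_N = 0`. -/
lemma exists_coord_ne_zero {Ω : Set (E n)} (hΩ : IsOpen Ω) {w : E n → ℝ} (hw : ContinuousOn w Ω)
    (N : Fin n) {x : E n} (hx : x ∈ Ω) (hlt : w x < |x N|) :
    ∃ y ∈ Ω, y N ≠ 0 ∧ w y < |y N| := by
  by_cases hN : x N = 0
  · set γ : ℝ → E n := fun t => x + t • EuclideanSpace.single N (1 : ℝ) with hγ
    have hγc : ContinuousAt γ 0 := by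
      simp only [hγ]
      fun_prop
    have hγ0 : γ 0 = x := by simp [hγ]
    have hγN : ∀ t, γ t N = t := fun t => by simp [hγ, hN]
    have h1 : ∀ᶠ t in nhds (0 : ℝ), γ t ∈ Ω :=
      hγc (by rw [hγ0]; exact hΩ.mem_nhds hx)
    have hwx : ContinuousAt w (γ 0) := by
      rw [hγ0]
      exact hw.continuousAt (hΩ.mem_nhds hx)
    have h2 : ∀ᶠ t in nhds (0 : ℝ), w (γ t) < |t| := by
      have h3 : ContinuousAt (fun t => w (γ t)) 0 := ContinuousAt.comp (f := γ) hwx hγc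
      refine h3.eventually_lt continuous_abs.continuousAt ?_
      simpa [hγ0, hN] using hlt
    obtain ⟨t, ⟨ht1, ht2⟩, ht0⟩ :=
      (((h1.and h2).filter_mono nhdsWithin_le_nhds).and
        (self_mem_nhdsWithin (s := Ioi (0 : ℝ)))).exists
    exact ⟨γ t, ht1, by rw [hγN]; exact ne_of_gt ht0, by rwa [hγN]⟩
  · exact ⟨x, hx, hN, hlt⟩

lemma pow_rpow_mul_pow {a Q p : ℝ} (ha : 0 ≤ a) (hQ : 0 ≤ Q) (n k : ℕ) :
    a * Q ^ k * ((a * Q ^ k) ^ n) ^ p = a * (a ^ n) ^ p * (Q * (Q ^ n) ^ p) ^ k := by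
  have h1 : (a * Q ^ k) ^ n = a ^ n * (Q ^ n) ^ k := by
    rw [mul_pow, ← pow_mul, ← pow_mul, mul_comm k n]
  rw [h1, Real.mul_rpow (by positivity) (by positivity), mul_pow,
    Real.rpow_pow_comm (by positivity)]
  ring

lemma symmSlope_half_le {Ω : Set (E n)} {T r : ℝ} {u : E n → ℝ → ℝ}
    (hreg : ParabolicRegular Ω (-T) 0 u) (hr : closedBall (0 : E n) r ⊆ Ω)
    {t : ℝ} (ht : t ∈ Icc (-T) 0) (hu : u 0 t ≤ 0) {e : E n} {s : ℝ} (hs : 0 < s)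
    (hse : s * ‖e‖ ≤ r) : symmSlope u e (s / 2) t ≤ symmSlope u e s t := by
  have hcl : closedBall (0 : E n) r ⊆ closure Ω := hr.trans subset_closure
  have key : ∀ e' : E n, s * ‖e'‖ ≤ r → u ((s / 2) • e') t ≤ u (s • e') t / 2 := fun e' he' => by
    have h1 : s • e' ∈ closedBall (0 : E n) r := by
      rwa [mem_closedBall_zero_iff, norm_smul, Real.norm_of_nonneg hs.le]
    have h0 : (0 : E n) ∈ closedBall (0 : E n) r := by
      rw [mem_closedBall_zero_iff, norm_zero]
      exact le_trans (by positivity) he'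
    have h2 := (hreg.conv t ht).2 (hcl h0) (hcl h1) (show (0 : ℝ) ≤ 1 / 2 by norm_num)
      (show (0 : ℝ) ≤ 1 / 2 by norm_num) (by norm_num)
    have h3 : (1 / 2 : ℝ) * s = s / 2 := by ring
    rw [smul_zero, zero_add, smul_smul, h3, smul_eq_mul, smul_eq_mul] at h2
    linarith
  have h1 := key e hse
  have h2 := key (-e) (by rwa [norm_neg])
  rw [symmSlope, symmSlope, div_le_div_iff₀ (by positivity) (by positivity)]
  nlinarith

lemma symmSlope_le_symmSlope {Ω : Set (E n)} {T r : ℝ} {u : E n → ℝ → ℝ}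
    (hreg : ParabolicRegular Ω (-T) 0 u) (hr : closedBall (0 : E n) r ⊆ Ω)
    {t t' : ℝ} (ht : t ∈ Icc (-T) 0) (ht' : t' ∈ Icc (-T) 0) (htt : t ≤ t') {e : E n} {s : ℝ}
    (hs : 0 < s) (hse : s * ‖e‖ ≤ r) : symmSlope u e s t ≤ symmSlope u e s t' := by
  have key : ∀ e' : E n, s * ‖e'‖ ≤ r → u (s • e') t ≤ u (s • e') t' := fun e' he' =>
    hreg.mono _ (subset_closure (hr (by
      rwa [mem_closedBall_zero_iff, norm_smul, Real.norm_of_nonneg hs.le]))) t ht t' ht' htt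
  have h1 := key e hse
  have h2 := key (-e) (by rwa [norm_neg])
  rw [symmSlope, symmSlope]
  gcongr

set_option maxHeartbeats 1000000 in
/-- An angle from below in direction `e` at time `0` cannot open up from an initial datum that is
smaller at `e`. -/
lemma false_of_lt_angle (hn : 1 ≤ n) {p lam Lam : ℝ} (hp : 0 < p) (hlam : 0 < lam)
    (hLam : 0 < Lam) {Ω : Set (E n)} {T : ℝ} {u : E n → ℝ → ℝ} (hΩo : IsOpen Ω) (hT : 0 < T)
    (hreg : ParabolicRegular Ω (-T) 0 u) (hsub : ViscSubsolution Lam p Ω (-T) 0 u)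
    (hsup : ViscSupersolution lam p Ω (-T) 0 u) (h0 : (0 : E n) ∈ Ω) (hu00 : u 0 0 = 0)
    (N : Fin n) (hangle : ∀ x ∈ Ω, |x N| ≤ u x 0)
    (hext : ExtremalPoint {x ∈ Ω | u x 0 = 0} 0) {e : E n} (heΩ : e ∈ Ω) (heN : e N ≠ 0)
    (hlt : u e (-T) < |e N|) : False := by
  obtain ⟨r, hr0, hr⟩ := Metric.nhds_basis_closedBall.mem_iff.1 (hΩo.mem_nhds h0)
  have hcl : closedBall (0 : E n) r ⊆ closure Ω := hr.trans subset_closure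
  have he : e ≠ 0 := by rintro rfl; simp at heN
  have hen : 0 < ‖e‖ := norm_pos_iff.2 he
  obtain ⟨ρ, hρ⟩ : ∃ ρ : ℝ, ρ = 2 * (n + 2) * ((n : ℝ) ^ 2 + 1) := ⟨_, rfl⟩
  have hρ0 : 0 < ρ := by rw [hρ]; positivity
  obtain ⟨h₀, hh₀, τ₀, hτ₀, -, hsec⟩ := exists_symm_section_subset hT hreg
    (fun x hx => (abs_nonneg _).trans (hangle x hx)) hext hr (show 0 < r / (2 * ρ) by positivity)
  obtain ⟨C, hC⟩ := exists_holder_const hLam.le hreg hsub hr0 hr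
  set a := |e N| with ha
  have ha0 : 0 < a := abs_pos.2 heN
  set c := a - u e (-T) with hc
  have hc0 : 0 < c := sub_pos.2 hlt
  have hTI : -T ∈ Icc (-T) 0 := ⟨le_rfl, by linarith⟩
  have h0I : (0 : ℝ) ∈ Icc (-T) 0 := ⟨by linarith, le_rfl⟩
  have hu0 : ∀ t ∈ Icc (-T) 0, u 0 t ≤ 0 := fun t ht =>
    hu00 ▸ hreg.mono 0 (subset_closure h0) t ht 0 h0I ht.2
  obtain ⟨σ, hσ0, hσ1, hσh, hσe⟩ : ∃ σ : ℝ, 0 < σ ∧ σ ≤ 1 ∧ σ ≤ h₀ ∧ σ * ‖e‖ ≤ r / 2 := by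
    refine ⟨min 1 (min h₀ (r / 2 / ‖e‖)), by positivity, min_le_left _ _,
      (min_le_right _ _).trans (min_le_left _ _), ?_⟩
    rw [← le_div_iff₀ hen]
    exact (min_le_right _ _).trans (min_le_right _ _)
  have hse : ∀ s, s ≤ σ → s * ‖e‖ ≤ r / 2 := fun s hs =>
    (mul_le_mul_of_nonneg_right hs hen.le).trans hσe
  have hmem : ∀ s, 0 < s → s ≤ σ → s • e ∈ Ω ∧ s • (-e) ∈ Ω := fun s hs hs' => by
    refine ⟨hr ?_, hr ?_⟩ <;> rw [mem_closedBall_zero_iff, norm_smul, Real.norm_of_nonneg hs.le]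
    · linarith [hse s hs']
    · rw [norm_neg]
      linarith [hse s hs']
  have hlow : ∀ s, 0 < s → s ≤ σ → s * a ≤ u (s • e) 0 ∧ s * a ≤ u (s • (-e)) 0 := by
    intro s hs hs'
    have h1 := hangle _ (hmem s hs hs').1
    have h2 := hangle _ (hmem s hs hs').2
    simp only [PiLp.smul_apply, PiLp.neg_apply, smul_eq_mul, abs_mul, abs_neg,
      abs_of_pos hs] at h1 h2
    exact ⟨h1, h2⟩
  have hslope : ∀ s, 0 < s → s ≤ σ → a ≤ symmSlope u e s 0 := fun s hs hs' => by
    rw [symmSlope, le_div_iff₀ (by positivity)]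
    linarith [hlow s hs hs']
  have hdrop : ∀ s, 0 < s → s ≤ σ → symmSlope u e s (-T) ≤ symmSlope u e s 0 - c / 2 := by
    intro s hs hs'
    have h1 : u (s • e) (-T) ≤ s * u e (-T) := by
      have h2 := (hreg.conv _ hTI).2 (subset_closure heΩ) (subset_closure h0) hs.le
        (show 0 ≤ 1 - s by linarith) (by ring)
      rw [smul_zero, add_zero, smul_eq_mul, smul_eq_mul] at h2
      have h3 := mul_nonpos_of_nonneg_of_nonpos (show 0 ≤ 1 - s by linarith) (hu0 _ hTI)
      linarith
    have h2 := hreg.mono _ (subset_closure (hmem s hs hs').2) _ hTI 0 h0I (by linarith)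
    have h3 := (hlow s hs hs').1
    have h4 : symmSlope u e s 0 - c / 2
        = (u (s • e) 0 + u (s • (-e)) 0 - s * c) / (2 * s) := by
      rw [symmSlope]; field_simp
    rw [h4, symmSlope]
    gcongr
    rw [hc]
    linarith
  have hpw : ∀ i : ℕ, (0 : ℝ) < (1 / 2) ^ i ∧ ((1 : ℝ) / 2) ^ i ≤ 1 := fun i =>
    ⟨by positivity, pow_le_one₀ (by norm_num) (by norm_num)⟩
  have hσi : ∀ i : ℕ, 0 < σ * (1 / 2) ^ i ∧ σ * (1 / 2) ^ i ≤ σ := fun i =>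
    ⟨mul_pos hσ0 (hpw i).1, mul_le_of_le_one_right hσ0.le (hpw i).2⟩
  have hbdd : BddBelow (range fun i : ℕ => symmSlope u e (σ * (1 / 2) ^ i) 0) :=
    ⟨a, by rintro _ ⟨i, rfl⟩; exact hslope _ (hσi i).1 (hσi i).2⟩
  set ω := ⨅ i : ℕ, symmSlope u e (σ * (1 / 2) ^ i) 0 with hω_def
  have hω : 0 < ω := ha0.trans_le (le_ciInf fun i => hslope _ (hσi i).1 (hσi i).2)
  obtain ⟨i₀, hi₀⟩ := exists_lt_of_ciInf_lt (show ω < ω + c / 4 by linarith)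
  obtain ⟨s, hs⟩ : ∃ s : ℕ → ℝ, ∀ i, s i = σ * (1 / 2) ^ (i₀ + i) := ⟨_, fun _ => rfl⟩
  have hs0 : ∀ i, 0 < s i := fun i => hs i ▸ (hσi _).1
  have hsσ : ∀ i, s i ≤ σ := fun i => hs i ▸ (hσi _).2
  have hsucc : ∀ i, s (i + 1) = s i / 2 := fun i => by rw [hs, hs, ← add_assoc, pow_succ]; ring
  have hωs : ∀ i, ω ≤ symmSlope u e (s i) 0 := fun i => by
    rw [hs]
    exact ciInf_le hbdd (i₀ + i)
  set q : ℝ := (1 / 2) ^ 128 * (((1 / 2) ^ 128) ^ n) ^ p with hq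
  have hq0 : 0 < q := by
    have : (0 : ℝ) < (1 / 2) ^ 128 := by positivity
    rw [hq]
    generalize (1 / 2 : ℝ) ^ 128 = Q at this ⊢
    positivity
  obtain ⟨R, hR2, hRτ, hRq⟩ : ∃ R : ℝ, 2 ≤ R ∧ T / τ₀ ≤ R ∧ 2 / q ≤ R :=
    ⟨max 2 (max (T / τ₀) (2 / q)), le_max_left _ _, (le_max_left _ _).trans (le_max_right _ _),
      (le_max_right _ _).trans (le_max_right _ _)⟩
  have hR0 : 0 < R := by linarith
  obtain ⟨K₀, hK₀⟩ := Filter.eventually_atTop.1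
    (((tendsto_mul_rpow_atTop_zero (a := Lam) (b := 128 * ρ ^ 2) (c := (9 + 28 * ρ) * R)
      (ω := ω) hp n).eventually_lt_const hlam).and (Filter.eventually_gt_atTop (10 / ω)))
  obtain ⟨t, ht⟩ : ∃ t : ℕ → ℝ, ∀ k, t k = -(T / R ^ k) := ⟨_, fun _ => rfl⟩
  have htneg : ∀ k, t k < 0 := fun k => by
    rw [ht]
    have : 0 < T / R ^ k := by positivity
    linarith
  have htT : ∀ k, -T ≤ t k := fun k => by
    rw [ht]
    have : T / R ^ k ≤ T := div_le_self hT.le (one_le_pow₀ (by linarith))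
    linarith
  have htI : ∀ k, t k ∈ Icc (-T) 0 := fun k => ⟨htT k, (htneg k).le⟩
  have htR : ∀ k, t k = R * t (k + 1) := fun k => by
    rw [ht, ht, pow_succ]
    field_simp
  have htτ : ∀ k, -τ₀ ≤ t (k + 1) := fun k => by
    have h1 := htT k
    rw [htR] at h1
    rw [div_le_iff₀ hτ₀] at hRτ
    have h2 : R * (-τ₀) ≤ R * t (k + 1) := by linarith
    exact le_of_mul_le_mul_left h2 hR0
  obtain ⟨δ, hδ, i₁, hgap⟩ := exists_diagonal_gap (G := fun i k => symmSlope u e (s i) (t k))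
    (d₀ := 1 / (2 * max K₀ 1)) hω hc0 (by positivity)
    (fun i k => by
      rw [hsucc]
      exact symmSlope_half_le hreg hr (htI k) (hu0 _ (htI k)) (hs0 i)
        ((hse _ (hsσ i)).trans (by linarith)))
    (fun k => by
      have h1 := symmSlope_le_symmSlope hreg hr (htI k) h0I (htneg k).le (hs0 0)
        (e := e) ((hse _ (hsσ 0)).trans (by linarith))
      rw [hs 0] at h1 ⊢
      exact h1.trans hi₀.le)
    (fun i => by
      have h1 : t 0 = -T := by rw [ht]; simp
      rw [h1]
      have h2 : symmSlope u e (s i) 0 ≤ ω + c / 4 := by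
        induction i with
        | zero => rw [hs 0]; exact hi₀.le
        | succ i ih =>
          rw [hsucc]
          exact (symmSlope_half_le hreg hr h0I (hu0 _ h0I) (hs0 i)
            ((hse _ (hsσ i)).trans (by linarith))).trans ih
      linarith [hdrop _ (hs0 i) (hsσ i)])
    (fun i k d hd hd' hG hG' => by
      have hK : max K₀ 1 ≤ 1 / (2 * d) := by
        rw [le_div_iff₀ (by positivity)]
        rw [le_div_iff₀ (by positivity)] at hd'
        linarith
      obtain ⟨hK1, hK2⟩ := hK₀ (1 / (2 * d)) ((le_max_left _ _).trans hK)
      have hK3 : 1 ≤ 1 / (2 * d) := (le_max_right _ _).trans hK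
      have h2s : s i = 2 * s (i + 1) := by rw [hsucc]; ring
      have hd1 : 1 / (2 * (1 / (2 * d))) = d := by field_simp
      have hd2 : 32 / (1 / (2 * d)) = 64 * d := by field_simp; norm_num
      rw [h2s] at hG hG' ⊢
      rw [← hd2]
      refine lt_symmSlope_of_lt hn hp hlam hLam hreg hsub hsup hu00 hr0 hr hρ
        (by field_simp; exact le_rfl) hsec he hω hK2 (hs0 (i + 1))
        ((div_le_self (hs0 _).le hK3).trans ((hsσ _).trans hσh)) ?_ (htτ k) (htneg _) (htT k) ?_
        hG (by rwa [hd1]) ?_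
      · rw [← h2s]
        exact (hse _ (hsσ i)).trans (by linarith)
      · rw [htR]
        nlinarith [htneg (k + 1)]
      · rw [htR k]
        have h3 := mul_le_mul_of_nonneg_right hK1.le (neg_nonneg.2 (htneg (k + 1)).le)
        linarith)
  have hholder : ∀ k, s (i₁ + 128 * k) * δ * ((s (i₁ + 128 * k) * δ) ^ n) ^ p
      ≤ C * (T / R ^ k) := by
    intro k
    set i := i₁ + 128 * k with hi
    have hsi := hs0 i
    have h1 : u (s i • e) (t k) + u (s i • (-e)) (t k) + 2 * (s i * δ)
        ≤ u (s i • e) 0 + u (s i • (-e)) 0 := by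
      have h2 := hgap k
      have h3 := hωs i
      have h4 : symmSlope u e (s i) (t k) + δ ≤ symmSlope u e (s i) 0 := by linarith
      have h5 : symmSlope u e (s i) (t k) + δ
          = (u (s i • e) (t k) + u (s i • (-e)) (t k) + 2 * (s i * δ)) / (2 * s i) := by
        rw [symmSlope]; field_simp
      rw [h5, symmSlope] at h4
      exact (div_le_div_iff_of_pos_right (by positivity)).1 h4
    have h6 : 0 < s i * δ := mul_pos hsi hδ
    have key : ∀ e' : E n, ‖e'‖ = ‖e‖ → s i * δ ≤ u (s i • e') 0 - u (s i • e') (t k) →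
        s i * δ * ((s i * δ) ^ n) ^ p ≤ C * (T / R ^ k) := by
      intro e' he' hd
      have h7 := hC (s i • e') (by
        rw [norm_smul, Real.norm_of_nonneg hsi.le, he']
        exact hse _ (hsσ i)) (t k) (htT k) (htneg k) (by linarith)
      rw [ht k, neg_neg, ← ht k] at h7
      refine le_trans ?_ h7
      have h8 : 0 ≤ u (s i • e') 0 - u (s i • e') (t k) := h6.le.trans hd
      gcongr
    rcases le_total (s i * δ) (u (s i • e) 0 - u (s i • e) (t k)) with h7 | h7
    · exact key e rfl h7
    · exact key (-e) (norm_neg e) (by linarith)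
  set b := σ * (1 / 2) ^ (i₀ + i₁) * δ with hb
  have hb0 : 0 < b := mul_pos (hσi _).1 hδ
  have hfin : ∀ k, b * (b ^ n) ^ p * (2 : ℝ) ^ k ≤ C * T := by
    intro k
    have h1 : s (i₁ + 128 * k) * δ = b * ((1 / 2) ^ 128) ^ k := by
      rw [hs, hb, ← add_assoc, pow_add _ (i₀ + i₁), pow_mul]
      ring
    have h2 := hholder k
    rw [h1, pow_rpow_mul_pow hb0.le (by positivity), ← hq, ← mul_div_assoc,
      le_div_iff₀ (by positivity), mul_assoc, ← mul_pow] at h2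
    refine le_trans ?_ h2
    have h3 : 2 ≤ q * R := by
      rw [div_le_iff₀ hq0] at hRq
      linarith
    gcongr
  have hB : 0 < b * (b ^ n) ^ p := by positivity
  obtain ⟨k, hk⟩ := pow_unbounded_of_one_lt (C * T / (b * (b ^ n) ^ p)) (one_lt_two (α := ℝ))
  rw [div_lt_iff₀ hB] at hk
  linarith [hfin k]

/-- Theorem 6.1: an angle from below at time `0` originates
from the initial data. -/
theorem stmt5 (n : ℕ) (hn : 1 ≤ n) (p lam Lam : ℝ)
    (hp : 0 < p) (hlam : 0 < lam) (hll : lam ≤ Lam)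
    (Ω : Set (E n)) (T : ℝ) (u : E n → ℝ → ℝ)
    (hΩo : IsOpen Ω) (hΩc : Convex ℝ Ω) (hΩb : Bornology.IsBounded Ω)
    (hT : 0 < T)
    (hu : ViscositySolution lam Lam p Ω (-T) 0 u)
    (h0 : (0 : E n) ∈ Ω) (hu00 : u 0 0 = 0)
    (hangle : ∀ x ∈ Ω, |x ⟨n-1, by omega⟩| ≤ u x 0)
    (hext : ExtremalPoint {x ∈ Ω | u x 0 = 0} 0) :
    ∀ x ∈ Ω, |x ⟨n-1, by omega⟩| ≤ u x (-T) := by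
  obtain ⟨hreg, hsub, hsup⟩ := hu
  have hTI : -T ∈ Icc (-T) 0 := ⟨le_rfl, by linarith⟩
  by_contra! hcon
  obtain ⟨x, hx, hlt⟩ := hcon
  have hw : ContinuousOn (fun x => u x (-T)) Ω :=
    hreg.cont.comp (f := fun x : E n => (x, -T)) (by fun_prop) fun x hx => ⟨subset_closure hx, hTI⟩
  obtain ⟨e, he, heN, hlt⟩ := exists_coord_ne_zero hΩo hw ⟨n - 1, by omega⟩ hx hlt
  exact false_of_lt_angle hn hp hlam (hlam.trans_le hll) hΩo hT hreg hsub hsup h0 hu00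
    ⟨n - 1, by omega⟩ hangle hext he heN hlt
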